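/- arXiv:2404.15755 — 2 statements merged into one kernel-verified Lean document; each statement's English description precedes it below -/
import Mathlib

section
/- Let (X,d) be a complete separable metric space. Then (P₂(X), W₂) is a geodesic space if and only if (X,d) is a geodesic space. Moreover, if (X,d) is a geodesic space, then (P₂(X), W₂) satisfies the nonnegative-curvature midpoint comparison if and only if (X,d) does. -/
open MeasureTheory Filter Set Topology ENNReal
open scoped Classical

noncomputable section

/-- A coupling of two measures. -/
def IsCoupling {α β : Type*} [MeasurableSpace α] [MeasurableSpace β]
    (q : Measure (α × β)) (μ : Measure α) (ν : Measure β) : Prop :=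
  Measure.map Prod.fst q = μ ∧ Measure.map Prod.snd q = ν

/-- Membership in the Wasserstein space `P₂`. -/
def MemP2 {α : Type*} [MetricSpace α] [MeasurableSpace α] (μ : Measure α) : Prop :=
  IsProbabilityMeasure μ ∧ ∃ x₀ : α, ∫⁻ x, edist x x₀ ^ 2 ∂μ < ∞

/-- The squared Kantorovich–Wasserstein distance. -/
def Wsq {α : Type*} [MetricSpace α] [MeasurableSpace α] (μ ν : Measure α) : ℝ≥0∞ :=
  ⨅ (q : Measure (α × α)) (_ : IsCoupling q μ ν), ∫⁻ p, edist p.1 p.2 ^ 2 ∂q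

/-- The Kantorovich–Wasserstein distance `W₂`. -/
def W2 {α : Type*} [MetricSpace α] [MeasurableSpace α] (μ ν : Measure α) : ℝ≥0∞ :=
  Wsq μ ν ^ (1/2 : ℝ)

/-- A `W₂`-geodesic parametrized by `[0,1]`. -/
def IsW2Geodesic {α : Type*} [MetricSpace α] [MeasurableSpace α] (μ : ℝ → Measure α) : Prop :=
  ∀ s ∈ Icc (0:ℝ) 1, ∀ t ∈ Icc (0:ℝ) 1,
    W2 (μ s) (μ t) = ENNReal.ofReal |s - t| * W2 (μ 0) (μ 1)

/-- Integrand of the Boltzmann entropy. -/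
def entFun {α : Type*} [MeasurableSpace α] (μ m : Measure α) (x : α) : ℝ :=
  (μ.rnDeriv m x).toReal * Real.log (μ.rnDeriv m x).toReal

/-- Boltzmann entropy `Ent(μ|m)`. -/
def Ent {α : Type*} [MeasurableSpace α] (μ m : Measure α) : EReal :=
  if μ ≪ m ∧ Integrable (fun x => max (entFun μ m x) 0) m then
    ((∫ x, max (entFun μ m x) 0 ∂m : ℝ) : EReal)
      - ((∫⁻ x, ENNReal.ofReal (-(entFun μ m x)) ∂m : ℝ≥0∞) : EReal)
  else ⊤

/-- The CD(K,∞) convexity inequality along some geodesic from `μ₀` to `μ₁`. -/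
def CDinftyFor {α : Type*} [MetricSpace α] [MeasurableSpace α]
    (K : ℝ) (m μ₀ μ₁ : Measure α) : Prop :=
  ∃ μ : ℝ → Measure α, μ 0 = μ₀ ∧ μ 1 = μ₁ ∧ IsW2Geodesic μ ∧
    ∀ t ∈ Icc (0:ℝ) 1,
      Ent (μ t) m ≤ ((1 - t : ℝ) : EReal) * Ent μ₀ m + ((t : ℝ) : EReal) * Ent μ₁ m
        - ((K/2 * (t * (1-t)) : ℝ) : EReal) * ((Wsq μ₀ μ₁ : ℝ≥0∞) : EReal)

/-- The curvature-dimension condition CD(K,∞). -/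
def CDinfty {α : Type*} [MetricSpace α] [MeasurableSpace α] (K : ℝ) (m : Measure α) : Prop :=
  ∀ μ₀ μ₁ : Measure α, MemP2 μ₀ → MemP2 μ₁ → CDinftyFor K m μ₀ μ₁

/-- Distortion coefficients `τ^{(t)}_{K,N}(θ)`. -/
def tauCoef (K N t θ : ℝ) : ℝ≥0∞ :=
  if 0 < K then
    if Real.pi * Real.sqrt ((N-1)/K) ≤ θ then ∞
    else ENNReal.ofReal (t ^ (1/N) *
      (Real.sin (Real.sqrt (K/(N-1)) * (t * θ)) / Real.sin (Real.sqrt (K/(N-1)) * θ)) ^ ((N-1)/N))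
  else if K = 0 then ENNReal.ofReal t
  else ENNReal.ofReal (t ^ (1/N) *
      (Real.sinh (Real.sqrt (-K/(N-1)) * (t * θ)) / Real.sinh (Real.sqrt (-K/(N-1)) * θ)) ^ ((N-1)/N))

/-- The CD(K,N) inequality along some geodesic/optimal coupling from `μ₀` to `μ₁`,
with distortion coefficients `coef`. -/
def CDForWith {α : Type*} [MetricSpace α] [MeasurableSpace α]
    (coef : ℝ → ℝ → ℝ≥0∞) (N : ℝ) (m μ₀ μ₁ : Measure α) : Prop :=
  ∃ (μ : ℝ → Measure α) (q : Measure (α × α)),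
    μ 0 = μ₀ ∧ μ 1 = μ₁ ∧ IsW2Geodesic μ ∧ (∀ t ∈ Icc (0:ℝ) 1, μ t ≪ m) ∧
    IsCoupling q μ₀ μ₁ ∧ (∫⁻ p, edist p.1 p.2 ^ 2 ∂q) = Wsq μ₀ μ₁ ∧
    ∀ t ∈ Icc (0:ℝ) 1,
      ∫⁻ x, ((μ t).rnDeriv m x) ^ (1 - 1/N : ℝ) ∂m ≥
      ∫⁻ p, coef (1-t) (dist p.1 p.2) * (μ₀.rnDeriv m p.1) ^ (-(1/N) : ℝ)
            + coef t (dist p.1 p.2) * (μ₁.rnDeriv m p.2) ^ (-(1/N) : ℝ) ∂q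

def CDFor {α : Type*} [MetricSpace α] [MeasurableSpace α]
    (K N : ℝ) (m μ₀ μ₁ : Measure α) : Prop :=
  CDForWith (fun t θ => tauCoef K N t θ) N m μ₀ μ₁

/-- The curvature-dimension condition CD(K,N). -/
def CD {α : Type*} [MetricSpace α] [MeasurableSpace α] (K N : ℝ) (m : Measure α) : Prop :=
  ∀ μ₀ μ₁ : Measure α, MemP2 μ₀ → MemP2 μ₁ → μ₀ ≪ m → μ₁ ≪ m → CDFor K N m μ₀ μ₁

/-- The support of a measure on a topological space. -/
def mmSupp {α : Type*} [TopologicalSpace α] [MeasurableSpace α] (μ : Measure α) : Set α :=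
  {x | ∀ U ∈ nhds x, 0 < μ U}


/-- A constant-speed geodesic parametrized by `[0,1]`. -/
def IsGeodCurve {α : Type*} [MetricSpace α] (γ : ℝ → α) : Prop :=
  ∀ s ∈ Icc (0:ℝ) 1, ∀ t ∈ Icc (0:ℝ) 1, dist (γ s) (γ t) = |s - t| * dist (γ 0) (γ 1)

/-- A geodesic metric space: any two points are joined by a constant-speed geodesic. -/
def GeodesicSpace (α : Type*) [MetricSpace α] : Prop :=
  ∀ x y : α, ∃ γ : ℝ → α, γ 0 = x ∧ γ 1 = y ∧ IsGeodCurve γ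

/-- Non-branching: geodesics that coincide on `[0,1/2]` coincide on `[0,1]`. -/
def NonBranching (α : Type*) [MetricSpace α] : Prop :=
  ∀ γ γ' : ℝ → α, IsGeodCurve γ → IsGeodCurve γ' →
    (∀ t ∈ Icc (0:ℝ) (1/2 : ℝ), γ t = γ' t) → ∀ t ∈ Icc (0:ℝ) 1, γ t = γ' t

/-- `(P₂(X), W₂)` is a geodesic space. -/
def GeodesicW2 (α : Type*) [MetricSpace α] [MeasurableSpace α] : Prop :=
  ∀ μ ν : Measure α, MemP2 μ → MemP2 ν → ∃ γ : ℝ → Measure α,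
    γ 0 = μ ∧ γ 1 = ν ∧ (∀ t ∈ Icc (0:ℝ) 1, MemP2 (γ t)) ∧ IsW2Geodesic γ

/-- The nonnegative-curvature midpoint comparison for a metric space. -/
def NNCurvMidpoint (α : Type*) [MetricSpace α] : Prop :=
  ∀ x y z w : α, dist y w = dist y z / 2 → dist z w = dist y z / 2 →
    dist x w ^ 2 ≥ dist x y ^ 2 / 2 + dist x z ^ 2 / 2 - dist y z ^ 2 / 4

/-- The nonnegative-curvature midpoint comparison for `(P₂(X), W₂)`. -/
def NNCurvW2 (α : Type*) [MetricSpace α] [MeasurableSpace α] : Prop :=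
  ∀ μ ν κ w : Measure α, MemP2 μ → MemP2 ν → MemP2 κ → MemP2 w →
    (W2 ν w).toReal = (W2 ν κ).toReal / 2 → (W2 κ w).toReal = (W2 ν κ).toReal / 2 →
    (W2 μ w).toReal ^ 2 ≥
      (W2 μ ν).toReal ^ 2 / 2 + (W2 μ κ).toReal ^ 2 / 2 - (W2 ν κ).toReal ^ 2 / 4

/-! ### Analytic sets are null-measurable, measurable selection -/

lemma cap_compact (n : ℕ → ℕ) (V : Set (ℕ → ℕ)) (hV : IsOpen V)
    (hK : ∀ σ : ℕ → ℕ, (∀ i, σ i ≤ n i) → σ ∈ V) :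
    ∃ k, ∀ σ : ℕ → ℕ, (∀ i < k, σ i ≤ n i) → σ ∈ V := by
  by_contra! hcon
  choose σ h1 h2 using hcon
  have hc : IsCompact (Set.univ.pi fun i => Set.Iic (n i)) :=
    isCompact_univ_pi fun i => (Set.finite_Iic (n i)).isCompact
  obtain ⟨τ, hτ, φ, hφ, hlim⟩ := hc.tendsto_subseq (x := fun k i => min (σ k i) (n i))
    (fun k i _ => by simp)
  have hτV : τ ∈ V := hK τ fun i => hτ i (Set.mem_univ i)
  have hlim2 : Tendsto (fun k => σ (φ k)) atTop (𝓝 τ) := by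
    rw [tendsto_pi_nhds] at hlim ⊢
    intro i
    refine (hlim i).congr' ?_
    filter_upwards [eventually_gt_atTop i] with k hk
    simp only [Function.comp]
    exact min_eq_left (h1 _ i (hk.trans_le (hφ.id_le k)))
  have := hlim2.eventually (hV.mem_nhds hτV)
  obtain ⟨k, hk⟩ := this.exists
  exact h2 _ hk

lemma analytic_inner {Y : Type*} [TopologicalSpace Y] [T2Space Y] [MeasurableSpace Y] [BorelSpace Y]
    (q : Measure Y) [IsFiniteMeasure q] [q.OuterRegular]
    (f : (ℕ → ℕ) → Y) (hf : Continuous f) (r : ℝ≥0∞) (hr : r < q (range f)) :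
    ∃ K ⊆ range f, MeasurableSet K ∧ r ≤ q K := by
  -- bounds
  have step : ∀ (k : ℕ) (B : Set (ℕ → ℕ)), r < q (f '' B) →
      ∃ m, r < q (f '' {σ ∈ B | σ k ≤ m}) := by
    intro k B hB
    have hU : f '' B = ⋃ m : ℕ, f '' {σ ∈ B | σ k ≤ m} := by
      rw [← image_iUnion]
      congr 1
      ext σ
      simp only [mem_iUnion, mem_ofPred_eq]
      exact ⟨fun h => ⟨σ k, h, le_rfl⟩, fun ⟨m, h, _⟩ => h⟩
    have hmono : Monotone fun m : ℕ => f '' {σ ∈ B | σ k ≤ m} := by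
      intro a b hab
      exact image_mono fun σ hσ => ⟨hσ.1, hσ.2.trans hab⟩
    rw [hU, hmono.measure_iUnion, lt_iSup_iff] at hB
    exact hB
  choose! N hN using step
  let B : ℕ → Set (ℕ → ℕ) := fun k => Nat.rec univ (fun k B => {σ ∈ B | σ k ≤ N k B}) k
  have hBs : ∀ k, B (k+1) = {σ ∈ B k | σ k ≤ N k (B k)} := fun k => rfl
  have hB : ∀ k, r < q (f '' B k) := by
    intro k
    induction k with
    | zero => simpa [B] using hr
    | succ k ih => rw [hBs]; exact hN k _ ih
  let n : ℕ → ℕ := fun k => N k (B k)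
  have hBn : ∀ k, B k = {σ | ∀ i < k, σ i ≤ n i} := by
    intro k
    induction k with
    | zero => simp [B]
    | succ k ih =>
      rw [hBs]
      ext σ
      rw [mem_ofPred_eq, mem_ofPred_eq]
      nth_rw 1 [ih]
      rw [mem_ofPred_eq]
      constructor
      · rintro ⟨h1, h2⟩ i hi
        rcases Nat.lt_succ_iff_lt_or_eq.1 hi with h | h
        · exact h1 i h
        · subst h; exact h2
      · intro h
        exact ⟨fun i hi => h i (by omega), h k (by omega)⟩
  have hc : IsCompact (Set.univ.pi fun i => Set.Iic (n i)) :=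
    isCompact_univ_pi fun i => (Set.finite_Iic (n i)).isCompact
  refine ⟨f '' (Set.univ.pi fun i => Set.Iic (n i)), image_subset_range _ _,
    (hc.image hf).isClosed.measurableSet, ?_⟩
  by_contra! hlt
  obtain ⟨U, hU, hUo, hUr⟩ := Set.exists_isOpen_lt_of_lt _ _ hlt
  obtain ⟨k, hk⟩ := cap_compact n (f ⁻¹' U) (hUo.preimage hf)
    (fun σ hσ => hU ⟨σ, fun i _ => hσ i, rfl⟩)
  have : f '' B k ⊆ U := by
    rintro _ ⟨σ, hσ, rfl⟩
    rw [hBn] at hσ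
    exact hk σ hσ
  exact absurd (hB k) (not_lt.2 ((measure_mono this).trans hUr.le))

lemma analytic_nullMeasurable {Y : Type*} [TopologicalSpace Y] [T2Space Y] [MeasurableSpace Y]
    [BorelSpace Y] (q : Measure Y) [IsFiniteMeasure q] [q.OuterRegular]
    (A : Set Y) (hA : AnalyticSet A) : NullMeasurableSet A q := by
  rw [AnalyticSet] at hA
  rcases hA with rfl | ⟨f, hf, rfl⟩
  · exact MeasurableSet.empty.nullMeasurableSet
  rcases eq_or_ne (q (range f)) 0 with h0 | h0
  · exact NullMeasurableSet.of_null h0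
  obtain ⟨u, -, hu, hlim⟩ := exists_seq_strictMono_tendsto' (pos_iff_ne_zero.2 h0)
  choose K hK hKm hKu using fun k => analytic_inner q f hf (u k) (hu k).2
  have hsub : (⋃ k, K k) ⊆ range f := iUnion_subset hK
  have hm : MeasurableSet (⋃ k, K k) := MeasurableSet.iUnion hKm
  have hge : q (range f) ≤ q (⋃ k, K k) :=
    le_of_tendsto' hlim fun k => (hKu k).trans (measure_mono (subset_iUnion K k))
  have := ae_eq_of_subset_of_measure_ge hsub hge hm.nullMeasurableSet (measure_ne_top _ _)
  exact hm.nullMeasurableSet.congr this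

/-- leftmost branch of the fibre -/
def selC {Y : Type*} (h : (ℕ → ℕ) → Y) (y : Y) : ℕ → Set (ℕ → ℕ) :=
  fun k => Nat.rec (h ⁻¹' {y}) (fun k C => {σ ∈ C | σ k = sInf ((fun τ : ℕ → ℕ => τ k) '' C)}) k

def sel {Y : Type*} (h : (ℕ → ℕ) → Y) (y : Y) : ℕ → ℕ :=
  fun k => sInf ((fun τ : ℕ → ℕ => τ k) '' selC h y k)

lemma selC_succ {Y : Type*} (h : (ℕ → ℕ) → Y) (y : Y) (k : ℕ) :
    selC h y (k+1) = {σ ∈ selC h y k | σ k = sel h y k} := rfl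

lemma mem_selC {Y : Type*} (h : (ℕ → ℕ) → Y) (y : Y) (k : ℕ) (σ : ℕ → ℕ) :
    σ ∈ selC h y k ↔ h σ = y ∧ ∀ i < k, σ i = sel h y i := by
  induction k with
  | zero => simp [selC]
  | succ k ih =>
    rw [selC_succ, mem_ofPred_eq, ih]
    constructor
    · rintro ⟨⟨h1, h2⟩, h3⟩
      refine ⟨h1, fun i hi => ?_⟩
      rcases Nat.lt_succ_iff_lt_or_eq.1 hi with h | h
      · exact h2 i h
      · subst h; exact h3
    · rintro ⟨h1, h2⟩
      exact ⟨⟨h1, fun i hi => h2 i (by omega)⟩, h2 k (by omega)⟩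

lemma selC_nonempty {Y : Type*} (h : (ℕ → ℕ) → Y) (hs : Function.Surjective h) (y : Y) (k : ℕ) :
    (selC h y k).Nonempty := by
  induction k with
  | zero => obtain ⟨σ, hσ⟩ := hs y; exact ⟨σ, hσ⟩
  | succ k ih =>
    have := Nat.sInf_mem (ih.image (fun τ : ℕ → ℕ => τ k))
    obtain ⟨σ, h1, h2⟩ := this
    exact ⟨σ, h1, h2⟩

lemma sel_spec {Y : Type*} [TopologicalSpace Y] [T2Space Y] (h : (ℕ → ℕ) → Y)
    (hc : Continuous h) (hs : Function.Surjective h) (y : Y) : h (sel h y) = y := by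
  choose σ hσ using selC_nonempty h hs y
  have hlim : Tendsto σ atTop (𝓝 (sel h y)) := by
    rw [tendsto_pi_nhds]
    intro i
    refine tendsto_const_nhds.congr' ?_
    filter_upwards [eventually_gt_atTop i] with k hk
    exact (((mem_selC h y k _).1 (hσ k)).2 i hk).symm
  have h1 := (hc.tendsto _).comp hlim
  have h2 : h ∘ σ = fun _ => y := by
    funext k
    exact ((mem_selC h y k _).1 (hσ k)).1
  rw [h2] at h1
  exact tendsto_nhds_unique h1 tendsto_const_nhds

lemma sel_eq_iff {Y : Type*} (h : (ℕ → ℕ) → Y) (hs : Function.Surjective h) (y : Y) (k j : ℕ) :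
    sel h y k = j ↔ (∃ σ, h σ = y ∧ (∀ i < k, σ i = sel h y i) ∧ σ k = j) ∧
      ∀ j' < j, ¬ ∃ σ, h σ = y ∧ (∀ i < k, σ i = sel h y i) ∧ σ k = j' := by
  have hne := (selC_nonempty h hs y k).image (fun τ : ℕ → ℕ => τ k)
  have key : ∀ j, (j ∈ ((fun τ : ℕ → ℕ => τ k) '' selC h y k)) ↔
      ∃ σ, h σ = y ∧ (∀ i < k, σ i = sel h y i) ∧ σ k = j := by
    intro j
    simp only [mem_image, mem_selC, and_assoc]
  simp only [← key]
  constructor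
  · rintro rfl
    exact ⟨Nat.sInf_mem hne, fun j' hj' => Nat.notMem_of_lt_sInf hj'⟩
  · rintro ⟨h1, h2⟩
    apply le_antisymm
    · exact Nat.sInf_le h1
    · by_contra! hlt
      exact h2 _ hlt (Nat.sInf_mem hne)

lemma isClosed_cyl (p : ℕ → ℕ) (k j : ℕ) :
    IsClosed {σ : ℕ → ℕ | (∀ i < k, σ i = p i) ∧ σ k = j} := by
  have : {σ : ℕ → ℕ | (∀ i < k, σ i = p i) ∧ σ k = j} =
      (⋂ i, ⋂ (_ : i < k), {σ | σ i = p i}) ∩ {σ | σ k = j} := by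
    ext σ; simp
  rw [this]
  refine IsClosed.inter (isClosed_iInter fun i => isClosed_iInter fun _ => ?_) ?_
  · exact isClosed_eq (continuous_apply i) continuous_const
  · exact isClosed_eq (continuous_apply k) continuous_const

lemma sel_aemeasurable {Y : Type*} [TopologicalSpace Y] [T2Space Y] [MeasurableSpace Y]
    [BorelSpace Y] (q : Measure Y) [IsFiniteMeasure q] [q.OuterRegular] (h : (ℕ → ℕ) → Y)
    (hc : Continuous h) (hs : Function.Surjective h) : AEMeasurable (sel h) q := by
  have hcyl : ∀ (p : ℕ → ℕ) (k j : ℕ),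
      NullMeasurableSet {y | ∃ σ, h σ = y ∧ (∀ i < k, σ i = p i) ∧ σ k = j} q := by
    intro p k j
    apply analytic_nullMeasurable
    have := (isClosed_cyl p k j).analyticSet.image_of_continuous hc
    convert this using 1
    ext y
    simp only [mem_ofPred_eq, mem_image]
    exact ⟨fun ⟨σ, h1, h2⟩ => ⟨σ, h2, h1⟩, fun ⟨σ, h1, h2⟩ => ⟨σ, h2, h1⟩⟩
  have hpre : ∀ (p : ℕ → ℕ) (k : ℕ), NullMeasurableSet {y | ∀ i < k, sel h y i = p i} q := by
    intro p k
    induction k with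
    | zero => simp
    | succ k ih =>
      have : {y | ∀ i < k + 1, sel h y i = p i} = {y | ∀ i < k, sel h y i = p i} ∩
          ({y | ∃ σ, h σ = y ∧ (∀ i < k, σ i = p i) ∧ σ k = p k} ∩
          ⋂ j', ⋂ (_ : j' < p k), {y | ∃ σ, h σ = y ∧ (∀ i < k, σ i = p i) ∧ σ k = j'}ᶜ) := by
        ext y
        have e1 : y ∈ {y | ∀ i < k + 1, sel h y i = p i} ↔
            (∀ i < k, sel h y i = p i) ∧ sel h y k = p k := by
          constructor
          · intro H; exact ⟨fun i hi => H i (by omega), H k (by omega)⟩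
          · rintro ⟨h1, h2⟩ i hi
            rcases Nat.lt_succ_iff_lt_or_eq.1 hi with h | h
            · exact h1 i h
            · subst h; exact h2
        rw [e1, mem_inter_iff, mem_ofPred_eq]
        refine and_congr_right fun hp => ?_
        rw [sel_eq_iff h hs]
        have e2 : ∀ σ : ℕ → ℕ, (∀ i < k, σ i = sel h y i) ↔ (∀ i < k, σ i = p i) :=
          fun σ => forall₂_congr fun i hi => by rw [hp i hi]
        simp only [e2, mem_inter_iff, mem_iInter, mem_ofPred_eq, mem_compl_iff]
      rw [this]
      refine ih.inter ((hcyl p k _).inter ?_)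
      exact NullMeasurableSet.iInter fun j' => NullMeasurableSet.iInter fun _ => (hcyl p k j').compl
  have hcoord : ∀ k j, NullMeasurableSet {y | sel h y k = j} q := by
    intro k j
    have : {y | sel h y k = j} = ⋃ l : List ℕ, ⋃ (_ : l.getD k 0 = j),
        {y | ∀ i < k + 1, sel h y i = l.getD i 0} := by
      ext y
      simp only [mem_ofPred_eq, mem_iUnion, exists_prop]
      constructor
      · intro hy
        refine ⟨List.ofFn (fun i : Fin (k+1) => sel h y i), ?_, fun i hi => ?_⟩
        · simp [-List.ofFn_succ, List.getD_eq_getElem?_getD, hy]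
        · simp [-List.ofFn_succ, List.getD_eq_getElem?_getD, hi]
      · rintro ⟨l, hl, hy⟩
        rw [hy k (by omega), hl]
    rw [this]
    exact NullMeasurableSet.iUnion fun l => NullMeasurableSet.iUnion fun _ => hpre _ _
  rw [aemeasurable_pi_iff]
  intro k
  apply NullMeasurable.aemeasurable
  intro s _
  have : (fun y => sel h y k) ⁻¹' s = ⋃ j ∈ s, {y | sel h y k = j} := by
    ext y; simp
  rw [this]
  exact NullMeasurableSet.biUnion (to_countable s) fun j _ => hcoord k j

/-! ### Zorn construction of geodesics from midpoints -/

lemma geodesic_of_midpoints {X : Type*} [MetricSpace X] [CompleteSpace X]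
    (hmid : ∀ x y : X, ∃ m, dist x m = dist x y / 2 ∧ dist m y = dist x y / 2) :
    GeodesicSpace X := by
  intro x y
  set D := dist x y with hD
  have hD0 : 0 ≤ D := dist_nonneg
  let P : Set (ℝ × X) → Prop := fun G =>
    (∀ p ∈ G, p.1 ∈ Icc (0:ℝ) 1) ∧ ∀ p ∈ G, ∀ r ∈ G, dist p.2 r.2 = |p.1 - r.1| * D
  have h0 : P {((0:ℝ), x), ((1:ℝ), y)} := by
    refine ⟨?_, ?_⟩
    · rintro p (rfl | rfl) <;> simp
    · rintro p (rfl | rfl) r (rfl | rfl) <;> simp [hD, dist_comm]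
  obtain ⟨G, hG0, hGmax⟩ := zorn_subset_nonempty {G | P G} (by
    intro c hc hchain hne
    refine ⟨⋃₀ c, ⟨?_, ?_⟩, fun s hs => subset_sUnion_of_mem hs⟩
    · rintro p ⟨s, hs, hp⟩
      exact (hc hs).1 p hp
    · rintro p ⟨s, hs, hp⟩ r ⟨t, ht, hr⟩
      rcases hchain.total hs ht with h | h
      · exact (hc ht).2 p (h hp) r hr
      · exact (hc hs).2 p hp r (h hr)) _ h0
  have hGP : P G := hGmax.prop
  have hins : ∀ p : ℝ × X, P (insert p G) → p ∈ G := fun p hp =>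
    hGmax.le_of_ge hp (subset_insert p G) (mem_insert p G)
  have hins' : ∀ (t : ℝ) (z : X), t ∈ Icc (0:ℝ) 1 → (∀ r ∈ G, dist z r.2 = |t - r.1| * D) →
      (t, z) ∈ G := by
    intro t z ht hz
    apply hins
    refine ⟨?_, ?_⟩
    · rintro p (rfl | hp)
      · exact ht
      · exact hGP.1 p hp
    · rintro p (rfl | hp) r (rfl | hr)
      · simp
      · exact hz r hr
      · rw [dist_comm, hz p hp, abs_sub_comm]
      · exact hGP.2 p hp r hr
  have h0G : ((0:ℝ), x) ∈ G := hG0 (by simp)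
  have h1G : ((1:ℝ), y) ∈ G := hG0 (by simp)
  -- the domain is closed
  let S : Set ℝ := Prod.fst '' G
  have hSc : IsClosed S := by
    apply IsSeqClosed.isClosed
    intro u t hu hlim
    choose p hp hpu using hu
    have hcau : CauchySeq fun n => (p n).2 := by
      rw [Metric.cauchySeq_iff']
      intro ε hε
      obtain ⟨N, hN⟩ := Metric.cauchySeq_iff'.1 hlim.cauchySeq (ε / (D + 1)) (by positivity)
      refine ⟨N, fun n hn => ?_⟩
      rw [hGP.2 _ (hp n) _ (hp N), hpu, hpu]
      have := hN n hn
      rw [Real.dist_eq, lt_div_iff₀ (by positivity)] at this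
      nlinarith [abs_nonneg (u n - u N)]
    obtain ⟨z, hz⟩ := cauchySeq_tendsto_of_complete hcau
    refine ⟨(t, z), ?_, rfl⟩
    apply hins'
    · refine isClosed_Icc.mem_of_tendsto hlim (Eventually.of_forall fun n => ?_)
      rw [← hpu]; exact hGP.1 _ (hp n)
    · intro r hr
      have l1 : Tendsto (fun n => dist (p n).2 r.2) atTop (𝓝 (dist z r.2)) :=
        hz.dist tendsto_const_nhds
      have l2 : Tendsto (fun n => |u n - r.1| * D) atTop (𝓝 (|t - r.1| * D)) :=
        ((hlim.sub_const _).abs).mul_const _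
      refine tendsto_nhds_unique l1 (l2.congr fun n => ?_)
      rw [hGP.2 _ (hp n) _ hr, hpu]
  have hSall : ∀ t ∈ Icc (0:ℝ) 1, t ∈ S := by
    intro t ht
    by_contra htS
    have hA : IsCompact (S ∩ Icc 0 t) := isCompact_Icc.inter_left hSc
    have hB : IsCompact (S ∩ Icc t 1) := isCompact_Icc.inter_left hSc
    obtain ⟨a, haA, ha⟩ := hA.exists_isGreatest ⟨0, ⟨_, h0G, rfl⟩, le_rfl, ht.1⟩
    obtain ⟨b, hbB, hb⟩ := hB.exists_isLeast ⟨1, ⟨_, h1G, rfl⟩, ht.2, le_rfl⟩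
    have hat : a < t := lt_of_le_of_ne haA.2.2 (fun h => htS (h ▸ haA.1))
    have htb : t < b := lt_of_le_of_ne hbB.2.1 (fun h => htS (h ▸ hbB.1))
    obtain ⟨⟨_, za⟩, hza, rfl⟩ := haA.1
    obtain ⟨⟨_, zb⟩, hzb, rfl⟩ := hbB.1
    simp only at *
    rename_i a b
    obtain ⟨m, hm1, hm2⟩ := hmid za zb
    have hab := hGP.2 _ hza _ hzb
    simp only at hab
    rw [abs_of_neg (by linarith)] at hab
    have hmG : ((a + b) / 2, m) ∈ G := by
      apply hins'
      · constructor <;> linarith [haA.2.1, hbB.2.2]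
      · intro r hr
        have hra := hGP.2 _ hza _ hr
        have hrb := hGP.2 _ hzb _ hr
        simp only at hra hrb
        have t1 := dist_triangle m za r.2
        have t2 := dist_triangle za m r.2
        have t3 := dist_triangle m zb r.2
        have t4 := dist_triangle zb m r.2
        rw [dist_comm m za] at t1
        rw [dist_comm zb m] at t4
        have hrI := hGP.1 r hr
        have hcase : r.1 ≤ a ∨ b ≤ r.1 := by
          rcases le_total r.1 t with h | h
          · exact Or.inl (ha ⟨⟨r, hr, rfl⟩, hrI.1, h⟩)
          · exact Or.inr (hb ⟨⟨r, hr, rfl⟩, h, hrI.2⟩)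
        rcases hcase with h | h
        · rw [abs_of_nonneg (by linarith)] at hra hrb ⊢
          nlinarith
        · rw [abs_of_nonpos (by linarith)] at hra hrb ⊢
          nlinarith
    have hmS : (a + b) / 2 ∈ S := ⟨_, hmG, rfl⟩
    rcases le_total ((a + b) / 2) t with h | h
    · have := ha ⟨hmS, by linarith [haA.2.1], h⟩
      linarith
    · have := hb ⟨hmS, h, by linarith [hbB.2.2]⟩
      linarith
  have hex : ∀ t : ℝ, ∃ z, t ∈ Icc (0:ℝ) 1 → (t, z) ∈ G := by
    intro t
    by_cases ht : t ∈ Icc (0:ℝ) 1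
    · obtain ⟨⟨_, z⟩, hz, rfl⟩ := hSall t ht
      exact ⟨z, fun _ => hz⟩
    · exact ⟨x, fun h => absurd h ht⟩
  choose γ hγ using hex
  have e0 : γ 0 = x := by
    have := hGP.2 _ (hγ 0 (by simp)) _ h0G
    simpa using this
  have e1 : γ 1 = y := by
    have := hGP.2 _ (hγ 1 (by simp)) _ h1G
    simpa using this
  refine ⟨γ, e0, e1, fun s hs t ht => ?_⟩
  rw [e0, e1]
  exact hGP.2 _ (hγ s hs) _ (hγ t ht)

/-! ### Couplings -/

lemma IsCoupling.swap {α : Type*} [MeasurableSpace α] {q : Measure (α × α)} {μ ν : Measure α}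
    (h : IsCoupling q μ ν) : IsCoupling (q.map Prod.swap) ν μ := by
  refine ⟨?_, ?_⟩
  · rw [Measure.map_map measurable_fst measurable_swap]; exact h.2
  · rw [Measure.map_map measurable_snd measurable_swap]; exact h.1

lemma IsCoupling.isProb {α β : Type*} [MeasurableSpace α] [MeasurableSpace β]
    {q : Measure (α × β)} {μ : Measure α} {ν : Measure β}
    (h : IsCoupling q μ ν) (hμ : IsProbabilityMeasure μ) : IsProbabilityMeasure q := by
  constructor
  have := hμ.measure_univ
  rw [← h.1, Measure.map_apply measurable_fst MeasurableSet.univ] at this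
  simpa using this

lemma isCoupling_prod {α β : Type*} [MeasurableSpace α] [MeasurableSpace β]
    (μ : Measure α) (ν : Measure β) [IsProbabilityMeasure μ] [IsProbabilityMeasure ν] :
    IsCoupling (μ.prod ν) μ ν := by
  refine ⟨?_, ?_⟩
  · have := Measure.fst_prod (μ := μ) (ν := ν); exact this
  · have := Measure.snd_prod (μ := μ) (ν := ν); exact this

lemma glue {α β γ : Type*} [MeasurableSpace α] [MeasurableSpace β] [MeasurableSpace γ]
    [StandardBorelSpace γ] [Nonempty γ] (π : Measure (α × β)) (q : Measure (β × γ))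
    [IsProbabilityMeasure π] [IsProbabilityMeasure q]
    (h : Measure.map Prod.snd π = Measure.map Prod.fst q) :
    ∃ g : Measure ((α × β) × γ), Measure.map Prod.fst g = π ∧
      Measure.map (fun p : (α × β) × γ => (p.1.2, p.2)) g = q := by
  let κ : ProbabilityTheory.Kernel (α × β) γ := q.condKernel.comap Prod.snd measurable_snd
  refine ⟨π.compProd κ, ?_, ?_⟩
  · have := Measure.fst_compProd π κ; exact this
  · apply Measure.ext_of_lintegral
    intro f hf
    rw [lintegral_map hf (by fun_prop), Measure.lintegral_compProd (by fun_prop)]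
    have h2 : ∫⁻ p, f p ∂q = ∫⁻ b, ∫⁻ c, f (b, c) ∂(q.condKernel b) ∂q.fst := by
      conv_lhs => rw [← q.disintegrate q.condKernel]
      rw [Measure.lintegral_compProd hf]
    rw [h2, Measure.fst, ← h, lintegral_map _ measurable_snd]
    · rfl
    · exact hf.lintegral_kernel_prod_right'

section W
variable {X : Type*} [MetricSpace X] [MeasurableSpace X]

lemma Wsq_le {μ ν : Measure X} {q : Measure (X × X)} (h : IsCoupling q μ ν) :
    Wsq μ ν ≤ ∫⁻ p, edist p.1 p.2 ^ 2 ∂q := iInf₂_le q h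

variable [BorelSpace X] [SecondCountableTopology X]

lemma meas_cost : Measurable fun p : X × X => edist p.1 p.2 ^ 2 := by fun_prop

lemma Wsq_comm_le (μ ν : Measure X) : Wsq μ ν ≤ Wsq ν μ := by
  refine le_iInf₂ fun q hq => ?_
  refine (Wsq_le hq.swap).trans_eq ?_
  rw [lintegral_map meas_cost measurable_swap]
  simp [edist_comm]

lemma Wsq_comm (μ ν : Measure X) : Wsq μ ν = Wsq ν μ :=
  le_antisymm (Wsq_comm_le μ ν) (Wsq_comm_le ν μ)

lemma W2_comm (μ ν : Measure X) : W2 μ ν = W2 ν μ := by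
  rw [W2, W2, Wsq_comm]

lemma W2_sq (μ ν : Measure X) : W2 μ ν ^ 2 = Wsq μ ν := by
  rw [W2, ← ENNReal.rpow_natCast, ← ENNReal.rpow_mul]; simp

lemma W2_real_sq (μ ν : Measure X) : (W2 μ ν).toReal ^ 2 = (Wsq μ ν).toReal := by
  rw [← ENNReal.toReal_pow, W2_sq]

lemma sq_add_le (a b : ℝ≥0∞) : (a + b) ^ 2 ≤ 2 * a ^ 2 + 2 * b ^ 2 := by
  by_cases ha : a = ∞
  · subst ha; simp
  by_cases hb : b = ∞
  · subst hb; simp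
  lift a to NNReal using ha
  lift b to NNReal using hb
  norm_cast
  have : ((a:ℝ) + b) ^ 2 ≤ 2 * a ^ 2 + 2 * b ^ 2 := by nlinarith [sq_nonneg ((a:ℝ) - b)]
  exact_mod_cast this

lemma MemP2.all {μ : Measure X} (h : MemP2 μ) (x : X) : ∫⁻ z, edist z x ^ 2 ∂μ < ∞ := by
  obtain ⟨hp, x₀, hx⟩ := h
  have : ∫⁻ z, edist z x ^ 2 ∂μ ≤ ∫⁻ z, (2 * edist z x₀ ^ 2 + 2 * edist x₀ x ^ 2) ∂μ := by
    refine lintegral_mono fun z => ?_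
    refine (pow_le_pow_left' (edist_triangle z x₀ x) 2).trans (sq_add_le _ _)
  refine this.trans_lt ?_
  rw [lintegral_add_right _ (by fun_prop), lintegral_const_mul _ (by fun_prop)]
  simp only [lintegral_const, measure_univ, mul_one]
  refine ENNReal.add_lt_top.2 ⟨ENNReal.mul_lt_top (by simp) hx, ENNReal.mul_lt_top (by simp) ?_⟩
  exact ENNReal.pow_lt_top (edist_lt_top _ _)

lemma Wsq_lt_top {μ ν : Measure X} (hμ : MemP2 μ) (hν : MemP2 ν) : Wsq μ ν < ∞ := by
  have := hμ.1
  have := hν.1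
  obtain ⟨x⟩ : Nonempty X := nonempty_of_isProbabilityMeasure μ
  refine (Wsq_le (isCoupling_prod μ ν)).trans_lt ?_
  have : ∫⁻ p, edist p.1 p.2 ^ 2 ∂(μ.prod ν) ≤
      ∫⁻ p, (2 * edist p.1 x ^ 2 + 2 * edist p.2 x ^ 2) ∂(μ.prod ν) := by
    refine lintegral_mono fun p => ?_
    refine (pow_le_pow_left' (edist_triangle_right p.1 p.2 x) 2).trans (sq_add_le _ _)
  refine this.trans_lt ?_
  rw [lintegral_add_right _ (by fun_prop), lintegral_const_mul _ (by fun_prop),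
    lintegral_const_mul _ (by fun_prop)]
  have e1 : ∫⁻ p, edist p.1 x ^ 2 ∂(μ.prod ν) = ∫⁻ z, edist z x ^ 2 ∂μ := by
    conv_rhs => rw [← (isCoupling_prod μ ν).1]
    rw [lintegral_map (by fun_prop) measurable_fst]
  have e2 : ∫⁻ p, edist p.2 x ^ 2 ∂(μ.prod ν) = ∫⁻ z, edist z x ^ 2 ∂ν := by
    conv_rhs => rw [← (isCoupling_prod μ ν).2]
    rw [lintegral_map (by fun_prop) measurable_snd]
  rw [e1, e2]
  exact ENNReal.add_lt_top.2 ⟨ENNReal.mul_lt_top (by simp) (hμ.all x),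
    ENNReal.mul_lt_top (by simp) (hν.all x)⟩

lemma W2_lt_top {μ ν : Measure X} (hμ : MemP2 μ) (hν : MemP2 ν) : W2 μ ν < ∞ :=
  ENNReal.rpow_lt_top_of_nonneg (by norm_num) (Wsq_lt_top hμ hν).ne

lemma Wsq_dirac (x : X) (μ : Measure X) [IsProbabilityMeasure μ] :
    Wsq (Measure.dirac x) μ = ∫⁻ z, edist x z ^ 2 ∂μ := by
  have key : ∀ q, IsCoupling q (Measure.dirac x) μ →
      ∫⁻ p, edist p.1 p.2 ^ 2 ∂q = ∫⁻ z, edist x z ^ 2 ∂μ := by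
    intro q hq
    have hae : ∀ᵐ p ∂q, p.1 = x := by
      have : ∀ᵐ z ∂(Measure.dirac x : Measure X), z = x := by
        rw [ae_dirac_eq]; simp
      rw [← hq.1] at this
      exact ae_of_ae_map measurable_fst.aemeasurable this
    rw [← hq.2, lintegral_map (by fun_prop) measurable_snd]
    refine lintegral_congr_ae ?_
    filter_upwards [hae] with p hp
    rw [hp]
  apply le_antisymm
  · rw [← key _ (isCoupling_prod (Measure.dirac x) μ)]
    exact Wsq_le (isCoupling_prod _ _)
  · exact le_iInf₂ fun q hq => (key q hq).ge

lemma memP2_dirac (x : X) : MemP2 (Measure.dirac x) :=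
  ⟨inferInstance, x, by rw [lintegral_dirac' _ (by fun_prop)]; simp⟩

lemma W2_dirac_dirac (x y : X) : W2 (Measure.dirac x) (Measure.dirac y) = edist x y := by
  rw [W2, Wsq_dirac, lintegral_dirac' _ (by fun_prop), ← ENNReal.rpow_natCast, ← ENNReal.rpow_mul]
  simp

/-- The key rigidity of midpoints. -/
lemma mid_rigid {Ω : Type*} [MeasurableSpace Ω] (g : Measure Ω) (a b c : Ω → ℝ≥0∞)
    (ha : Measurable a) (hb : Measurable b) (hc : Measurable c) (hac : ∀ ω, a ω ≠ ∞)
    (hbc : ∀ ω, b ω ≠ ∞)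
    (htri : ∀ ω, c ω ≤ a ω + b ω) (D : ℝ≥0∞) (hD : D ≠ ∞)
    (h1 : 4 * ∫⁻ ω, a ω ^ 2 ∂g ≤ D) (h2 : 4 * ∫⁻ ω, b ω ^ 2 ∂g ≤ D) (h3 : D ≤ ∫⁻ ω, c ω ^ 2 ∂g) :
    (∀ᵐ ω ∂g, (a ω).toReal = (c ω).toReal / 2 ∧ (b ω).toReal = (c ω).toReal / 2) ∧
      ∫⁻ ω, c ω ^ 2 ∂g = D := by
  have hle : ∀ ω, c ω ^ 2 ≤ 2 * a ω ^ 2 + 2 * b ω ^ 2 := fun ω =>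
    (pow_le_pow_left' (htri ω) 2).trans (sq_add_le _ _)
  have hint : ∫⁻ ω, (2 * a ω ^ 2 + 2 * b ω ^ 2) ∂g ≤ D := by
    rw [lintegral_add_right _ (by fun_prop), lintegral_const_mul _ (by fun_prop),
      lintegral_const_mul _ (by fun_prop)]
    have : 2 * (2 * ∫⁻ ω, a ω ^ 2 ∂g + 2 * ∫⁻ ω, b ω ^ 2 ∂g) ≤ 2 * D := by
      calc _ = 4 * ∫⁻ ω, a ω ^ 2 ∂g + 4 * ∫⁻ ω, b ω ^ 2 ∂g := by ring
        _ ≤ D + D := add_le_add h1 h2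
        _ = 2 * D := by ring
    exact (ENNReal.mul_le_mul_iff_right (by simp) (by simp)).1 this
  have hcD : ∫⁻ ω, c ω ^ 2 ∂g = D := le_antisymm ((lintegral_mono hle).trans hint) h3
  refine ⟨?_, hcD⟩
  have hae := ae_eq_of_ae_le_of_lintegral_le (Eventually.of_forall hle) (hcD ▸ hD) (by fun_prop)
    (hint.trans h3)
  filter_upwards [hae] with ω hω
  have hcc : c ω ≠ ∞ := ne_top_of_le_ne_top (ENNReal.add_ne_top.2 ⟨hac ω, hbc ω⟩) (htri ω)
  have t := htri ω
  have hac := hac ω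
  have hbc := hbc ω
  generalize a ω = a at *
  generalize b ω = b at *
  generalize c ω = c at *
  lift a to NNReal using hac
  lift b to NNReal using hbc
  lift c to NNReal using hcc
  norm_cast at hω t
  have t' : (c:ℝ) ≤ a + b := by exact_mod_cast t
  have e : (c:ℝ) ^ 2 = 2 * a ^ 2 + 2 * b ^ 2 := by exact_mod_cast hω
  simp only [ENNReal.coe_toReal]
  have hc0 : (0:ℝ) ≤ c := c.2
  have ha0 : (0:ℝ) ≤ a := a.2
  have hb0 : (0:ℝ) ≤ b := b.2
  have hab : (a:ℝ) = b := by
    have : ((a:ℝ) - b) ^ 2 ≤ 0 := by nlinarith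
    have := pow_eq_zero_iff (two_ne_zero) |>.1 (le_antisymm this (sq_nonneg _))
    linarith
  have : (c:ℝ) = 2 * a := by
    rw [← hab] at e
    have : ((c:ℝ) - 2 * a) * (c + 2 * a) = 0 := by linarith
    rcases mul_eq_zero.1 this with h | h
    · linarith
    · linarith
  constructor <;> linarith

end W

section W
variable {X : Type*} [MetricSpace X] [MeasurableSpace X]
  [BorelSpace X] [SecondCountableTopology X] [CompleteSpace X]

lemma lsc_cost : LowerSemicontinuous fun q : ProbabilityMeasure (X × X) =>
    ∫⁻ p, edist p.1 p.2 ^ 2 ∂(q : Measure (X × X)) := by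
  let f : ℕ → BoundedContinuousFunction (X × X) NNReal := fun n =>
    BoundedContinuousFunction.mkOfBound ⟨fun p => min (nndist p.1 p.2 ^ 2) n, by fun_prop⟩ n (by
      intro p r
      rw [NNReal.dist_eq, abs_le]
      simp only [ContinuousMap.coe_mk]
      have h1 : ((min (nndist p.1 p.2 ^ 2) (n : NNReal) : NNReal) : ℝ) ≤ n := by
        exact_mod_cast min_le_right _ _
      have h2 : ((min (nndist r.1 r.2 ^ 2) (n : NNReal) : NNReal) : ℝ) ≤ n := by
        exact_mod_cast min_le_right _ _
      have h3 := (min (nndist p.1 p.2 ^ 2) (n : NNReal)).2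
      have h4 := (min (nndist r.1 r.2 ^ 2) (n : NNReal)).2
      simp only [NNReal.val_eq_coe] at h3 h4
      constructor <;> linarith)
  have hfe : ∀ n p, f n p = min (nndist p.1 p.2 ^ 2) (n : NNReal) := fun n p => rfl
  have hsup : ∀ p : X × X, edist p.1 p.2 ^ 2 = ⨆ n, (f n p : ℝ≥0∞) := by
    intro p
    apply le_antisymm
    · obtain ⟨n, hn⟩ := exists_nat_ge (nndist p.1 p.2 ^ 2)
      refine le_iSup_of_le n ?_
      rw [hfe, min_eq_left hn, edist_nndist]
      simp
    · refine iSup_le fun n => ?_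
      rw [hfe, edist_nndist]
      exact_mod_cast min_le_left _ _
  have heq : (fun q : ProbabilityMeasure (X × X) =>
      ∫⁻ p, edist p.1 p.2 ^ 2 ∂(q : Measure (X × X))) =
      fun q : ProbabilityMeasure (X × X) => ⨆ n, ∫⁻ p, (f n p : ℝ≥0∞) ∂(q : Measure (X × X)) := by
    funext q
    rw [← lintegral_iSup]
    · exact lintegral_congr hsup
    · intro n; exact (f n).continuous.measurable.coe_nnreal_ennreal
    · intro n m hnm p
      simp only [hfe]
      norm_cast
      exact min_le_min_left _ (by exact_mod_cast hnm)
  rw [heq]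
  refine lowerSemicontinuous_iSup fun n => Continuous.lowerSemicontinuous ?_
  rw [continuous_iff_continuousAt]
  intro q
  exact (ProbabilityMeasure.tendsto_iff_forall_lintegral_tendsto.1 tendsto_id) (f n)

lemma exists_optimal (μ ν : Measure X) [hμ : IsProbabilityMeasure μ] [hν : IsProbabilityMeasure ν] :
    ∃ q, IsCoupling q μ ν ∧ ∫⁻ p, edist p.1 p.2 ^ 2 ∂q = Wsq μ ν := by
  let S : Set (ProbabilityMeasure (X × X)) := {q | IsCoupling (q : Measure (X × X)) μ ν}
  have hclosed : IsClosed S := by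
    have : S = {q | q.map (continuous_fst (X := X) (Y := X)).measurable.aemeasurable = ⟨μ, hμ⟩} ∩
        {q | q.map (continuous_snd (X := X) (Y := X)).measurable.aemeasurable = ⟨ν, hν⟩} := by
      ext q
      simp only [S, mem_inter_iff, mem_ofPred_eq, IsCoupling]
      exact ⟨fun h => ⟨Subtype.ext h.1, Subtype.ext h.2⟩,
        fun h => ⟨congrArg Subtype.val h.1, congrArg Subtype.val h.2⟩⟩
    rw [this]
    exact (isClosed_eq (ProbabilityMeasure.continuous_map continuous_fst) continuous_const).inter
      (isClosed_eq (ProbabilityMeasure.continuous_map continuous_snd) continuous_const)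
  have htight : IsTightMeasureSet {((q : ProbabilityMeasure (X × X)) : Measure (X × X)) | q ∈ S} := by
    rw [isTightMeasureSet_iff_exists_isCompact_measure_compl_le]
    intro ε hε
    have t1 := isTightMeasureSet_iff_exists_isCompact_measure_compl_le.1
      (isTightMeasureSet_singleton (μ := μ)) (ε / 2) (ENNReal.half_pos hε.ne')
    have t2 := isTightMeasureSet_iff_exists_isCompact_measure_compl_le.1
      (isTightMeasureSet_singleton (μ := ν)) (ε / 2) (ENNReal.half_pos hε.ne')
    obtain ⟨K, hK, hK'⟩ := t1
    obtain ⟨L, hL, hL'⟩ := t2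
    refine ⟨K ×ˢ L, hK.prod hL, ?_⟩
    rintro _ ⟨q, hq, rfl⟩
    have hsub : (K ×ˢ L)ᶜ ⊆ (Prod.fst ⁻¹' Kᶜ) ∪ (Prod.snd ⁻¹' Lᶜ) := by
      intro p hp
      by_contra hcon
      simp only [mem_union, mem_preimage, mem_compl_iff, not_or, not_not] at hcon
      exact hp ⟨hcon.1, hcon.2⟩
    refine (measure_mono hsub).trans ((measure_union_le _ _).trans ?_)
    rw [← Measure.map_apply measurable_fst hK.isClosed.measurableSet.compl,
      ← Measure.map_apply measurable_snd hL.isClosed.measurableSet.compl, hq.1, hq.2]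
    exact (add_le_add (hK' _ rfl) (hL' _ rfl)).trans_eq (ENNReal.add_halves ε)
  have hcomp : IsCompact S := by
    have := isCompact_closure_of_isTightMeasureSet htight
    rwa [hclosed.closure_eq] at this
  have hne : S.Nonempty := ⟨⟨μ.prod ν, inferInstance⟩, isCoupling_prod μ ν⟩
  obtain ⟨q, hq, hmin⟩ := LowerSemicontinuousOn.exists_isMinOn hne hcomp
    (lsc_cost.lowerSemicontinuousOn S)
  refine ⟨q, hq, le_antisymm ?_ (Wsq_le hq)⟩
  refine le_iInf₂ fun r hr => ?_
  exact hmin (a := ⟨r, hr.isProb hμ⟩) hr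

lemma W2_triangle (μ ν κ : Measure X) [hμ : IsProbabilityMeasure μ] [hν : IsProbabilityMeasure ν]
    [hκ : IsProbabilityMeasure κ] : W2 μ κ ≤ W2 μ ν + W2 ν κ := by
  obtain ⟨x⟩ : Nonempty X := nonempty_of_isProbabilityMeasure μ
  have : Nonempty X := ⟨x⟩
  obtain ⟨q1, hq1, e1⟩ := exists_optimal μ ν
  obtain ⟨q2, hq2, e2⟩ := exists_optimal ν κ
  have := hq1.isProb hμ
  have := hq2.isProb hν
  obtain ⟨g, hg1, hg2⟩ := glue q1 q2 (hq1.2.trans hq2.1.symm)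
  have hc : IsCoupling (g.map fun p => (p.1.1, p.2)) μ κ := by
    refine ⟨?_, ?_⟩
    · rw [← hq1.1, ← hg1, Measure.map_map measurable_fst (by fun_prop),
        Measure.map_map measurable_fst (by fun_prop)]; rfl
    · rw [← hq2.2, ← hg2, Measure.map_map measurable_snd (by fun_prop),
        Measure.map_map measurable_snd (by fun_prop)]; rfl
  have e1' : Wsq μ ν = ∫⁻ p, edist p.1.1 p.1.2 ^ (2:ℝ) ∂g := by
    rw [← e1, ← hg1, lintegral_map meas_cost (by fun_prop)]; simp
  have e2' : Wsq ν κ = ∫⁻ p, edist p.1.2 p.2 ^ (2:ℝ) ∂g := by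
    rw [← e2, ← hg2, lintegral_map meas_cost (by fun_prop)]; simp
  have e3 : Wsq μ κ ≤ ∫⁻ p, edist p.1.1 p.2 ^ (2:ℝ) ∂g := by
    refine (Wsq_le hc).trans_eq ?_
    rw [lintegral_map meas_cost (by fun_prop)]; simp
  have mink := ENNReal.lintegral_Lp_add_le (μ := g) (p := 2)
    (f := fun p => edist p.1.1 p.1.2) (g := fun p => edist p.1.2 p.2)
    (by fun_prop) (by fun_prop) (by norm_num)
  rw [W2, W2, W2, e1', e2']
  refine le_trans ?_ mink
  refine ENNReal.rpow_le_rpow (e3.trans ?_) (by norm_num)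
  refine lintegral_mono fun p => ENNReal.rpow_le_rpow ?_ (by norm_num)
  exact edist_triangle _ _ _

/-- Measurable selection of geodesics. -/
lemma exists_geod_selection [Nonempty X] (hX : GeodesicSpace X) (q : Measure (X × X))
    [IsFiniteMeasure q] :
    ∃ Φ : ℝ → X × X → X, (∀ t, AEMeasurable (Φ t) q) ∧ (∀ p, Φ 0 p = p.1) ∧ (∀ p, Φ 1 p = p.2) ∧
      ∀ s ∈ Icc (0:ℝ) 1, ∀ t ∈ Icc (0:ℝ) 1, ∀ p, dist (Φ s p) (Φ t p) = |s - t| * dist p.1 p.2 := by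
  let G : Set C(unitInterval, X) :=
    {γ | ∀ s t : unitInterval, dist (γ s) (γ t) = |(s:ℝ) - t| * dist (γ 0) (γ 1)}
  have hG : IsClosed G := by
    have : G = ⋂ s : unitInterval, ⋂ t : unitInterval,
        {γ : C(unitInterval, X) | dist (γ s) (γ t) = |(s:ℝ) - t| * dist (γ 0) (γ 1)} := by
      ext γ; simp only [G, mem_iInter, mem_ofPred_eq]
    rw [this]
    refine isClosed_iInter fun s => isClosed_iInter fun t => isClosed_eq ?_ ?_
    · exact (continuous_eval_const s).dist (continuous_eval_const t)
    · exact continuous_const.mul ((continuous_eval_const _).dist (continuous_eval_const _))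
  have hP : PolishSpace G := hG.polishSpace
  have hsurj : ∀ p : X × X, ∃ γ : G, γ.1 0 = p.1 ∧ γ.1 1 = p.2 := by
    rintro ⟨x, y⟩
    obtain ⟨γ, h0, h1, hγ⟩ := hX x y
    have hlip : LipschitzWith (nndist x y) fun t : unitInterval => γ t := by
      apply LipschitzWith.of_dist_le_mul
      intro s t
      rw [hγ s s.2 t t.2, h0, h1, mul_comm]
      rfl
    refine ⟨⟨⟨fun t => γ t, hlip.continuous⟩, ?_⟩, ?_, ?_⟩
    · intro s t
      simpa using hγ s s.2 t t.2
    · simpa using h0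
    · simpa using h1
  have hGne : Nonempty G := ⟨(hsurj (Classical.arbitrary _)).choose⟩
  obtain ⟨f, hf, hfs⟩ := PolishSpace.exists_nat_nat_continuous_surjective G
  have hev : ∀ t, Continuous fun σ => (f σ).1 t := fun t =>
    (continuous_eval_const t).comp (continuous_subtype_val.comp hf)
  let h : (ℕ → ℕ) → X × X := fun σ => ((f σ).1 0, (f σ).1 1)
  have hc : Continuous h := (hev 0).prodMk (hev 1)
  have hs : Function.Surjective h := by
    intro p
    obtain ⟨γ, h0, h1⟩ := hsurj p
    obtain ⟨σ, rfl⟩ := hfs γ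
    exact ⟨σ, Prod.ext h0 h1⟩
  have hsel := sel_aemeasurable q h hc hs
  have hspec := sel_spec h hc hs
  refine ⟨fun t p => (f (sel h p)).1 (projIcc 0 1 zero_le_one t), fun t => ?_, fun p => ?_,
    fun p => ?_, fun s hs t ht p => ?_⟩
  · exact (hev _).measurable.comp_aemeasurable hsel
  · have := congrArg Prod.fst (hspec p)
    simpa [h] using this
  · have := congrArg Prod.snd (hspec p)
    simpa [h] using this
  · have h0 := congrArg Prod.fst (hspec p)
    have h1 := congrArg Prod.snd (hspec p)
    have := (f (sel h p)).2 (projIcc 0 1 zero_le_one s) (projIcc 0 1 zero_le_one t)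
    simp only [h] at h0 h1
    rw [h0, h1] at this
    rw [this, projIcc_of_mem _ hs, projIcc_of_mem _ ht]

lemma geodesicW2_of_geodesic (hX : GeodesicSpace X) : GeodesicW2 X := by
  intro μ ν hμ hν
  have hμp := hμ.1
  have hνp := hν.1
  have hne : Nonempty X := nonempty_of_isProbabilityMeasure μ
  obtain ⟨q, hq, hopt⟩ := exists_optimal μ ν
  have hqp := hq.isProb hμp
  obtain ⟨Φ, hm, h0, h1, hd⟩ := exists_geod_selection hX q
  have hprob : ∀ t, IsProbabilityMeasure (q.map (Φ t)) := fun t =>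
    Measure.isProbabilityMeasure_map (hm t)
  have hed : ∀ s ∈ Icc (0:ℝ) 1, ∀ t ∈ Icc (0:ℝ) 1, ∀ p,
      edist (Φ s p) (Φ t p) = ENNReal.ofReal |s - t| * edist p.1 p.2 := by
    intro s hs t ht p
    rw [edist_dist, hd s hs t ht, ENNReal.ofReal_mul (abs_nonneg _), edist_dist p.1]
  have e0 : q.map (Φ 0) = μ := by rw [← hq.1]; congr 1; exact funext h0
  have e1 : q.map (Φ 1) = ν := by rw [← hq.2]; congr 1; exact funext h1
  have hle : ∀ s ∈ Icc (0:ℝ) 1, ∀ t ∈ Icc (0:ℝ) 1,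
      W2 (q.map (Φ s)) (q.map (Φ t)) ≤ ENNReal.ofReal |s - t| * W2 μ ν := by
    intro s hs t ht
    have hpair : AEMeasurable (fun p => (Φ s p, Φ t p)) q := (hm s).prodMk (hm t)
    have hc : IsCoupling (q.map fun p => (Φ s p, Φ t p)) (q.map (Φ s)) (q.map (Φ t)) := by
      refine ⟨?_, ?_⟩
      · rw [AEMeasurable.map_map_of_aemeasurable measurable_fst.aemeasurable hpair]; rfl
      · rw [AEMeasurable.map_map_of_aemeasurable measurable_snd.aemeasurable hpair]; rfl
    have hw : Wsq (q.map (Φ s)) (q.map (Φ t)) ≤ ENNReal.ofReal |s - t| ^ 2 * Wsq μ ν := by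
      refine (Wsq_le hc).trans_eq ?_
      rw [lintegral_map' meas_cost.aemeasurable hpair, ← hopt,
        ← lintegral_const_mul _ meas_cost]
      refine lintegral_congr fun p => ?_
      rw [hed s hs t ht, mul_pow]
    rw [W2, W2]
    refine (ENNReal.rpow_le_rpow hw (by norm_num)).trans_eq ?_
    rw [ENNReal.mul_rpow_of_nonneg _ _ (by norm_num), ← ENNReal.rpow_natCast, ← ENNReal.rpow_mul]
    simp
  have hWfin : W2 μ ν ≠ ∞ := (W2_lt_top hμ hν).ne
  have hmain : ∀ s ∈ Icc (0:ℝ) 1, ∀ t ∈ Icc (0:ℝ) 1, s ≤ t →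
      W2 (q.map (Φ s)) (q.map (Φ t)) = ENNReal.ofReal |s - t| * W2 μ ν := by
    intro s hs t ht hst
    refine le_antisymm (hle s hs t ht) ?_
    have z0 : (0:ℝ) ∈ Icc (0:ℝ) 1 := by simp
    have z1 : (1:ℝ) ∈ Icc (0:ℝ) 1 := by simp
    have tri : W2 μ ν ≤ ENNReal.ofReal s * W2 μ ν + (W2 (q.map (Φ s)) (q.map (Φ t)) +
        ENNReal.ofReal (1 - t) * W2 μ ν) := by
      have a1 := hle 0 z0 s hs
      have a2 := hle t ht 1 z1
      rw [zero_sub, abs_neg, abs_of_nonneg hs.1] at a1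
      rw [abs_sub_comm, abs_of_nonneg (by linarith [ht.2])] at a2
      have b1 := W2_triangle (q.map (Φ 0)) (q.map (Φ s)) (q.map (Φ 1))
      have b2 := W2_triangle (q.map (Φ s)) (q.map (Φ t)) (q.map (Φ 1))
      nth_rw 1 [← e0, ← e1]
      exact b1.trans (add_le_add a1 (b2.trans (by gcongr)))
    rw [abs_sub_comm, abs_of_nonneg (by linarith)]
    have hfin : W2 (q.map (Φ s)) (q.map (Φ t)) ≠ ∞ :=
      ne_top_of_le_ne_top (ENNReal.mul_ne_top (by simp) hWfin) (hle s hs t ht)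
    generalize W2 (q.map (Φ s)) (q.map (Φ t)) = w at *
    generalize W2 μ ν = d at *
    lift w to NNReal using hfin
    lift d to NNReal using hWfin
    have tri' := ENNReal.toReal_mono (by finiteness) tri
    rw [ENNReal.toReal_add (by finiteness) (by finiteness),
      ENNReal.toReal_add (by finiteness) (by finiteness), ENNReal.toReal_mul, ENNReal.toReal_mul,
      ENNReal.toReal_ofReal hs.1, ENNReal.toReal_ofReal (by linarith [ht.2])] at tri'
    simp only [ENNReal.coe_toReal] at tri'
    rw [← ENNReal.toReal_le_toReal (by finiteness) (by finiteness), ENNReal.toReal_mul,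
      ENNReal.toReal_ofReal (by linarith)]
    simp only [ENNReal.coe_toReal]
    linarith
  refine ⟨fun t => q.map (Φ t), e0, e1, fun t ht => ?_, fun s hs t ht => ?_⟩
  · refine ⟨hprob t, ?_⟩
    obtain ⟨x⟩ := hne
    refine ⟨x, ?_⟩
    rw [lintegral_map' (by fun_prop) (hm t)]
    have z0 : (0:ℝ) ∈ Icc (0:ℝ) 1 := by simp
    have hb : ∫⁻ p, edist (Φ t p) x ^ 2 ∂q ≤
        ∫⁻ p, (2 * (ENNReal.ofReal |t - 0| ^ 2 * edist p.1 p.2 ^ 2) + 2 * edist p.1 x ^ 2) ∂q := by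
      refine lintegral_mono fun p => ?_
      refine (pow_le_pow_left' (edist_triangle _ (Φ 0 p) _) 2).trans ((sq_add_le _ _).trans_eq ?_)
      rw [hed t ht 0 z0, mul_pow, h0]
    refine hb.trans_lt ?_
    rw [lintegral_add_right _ (by fun_prop), lintegral_const_mul _ (by fun_prop),
      lintegral_const_mul _ (by fun_prop), lintegral_const_mul _ (by fun_prop), hopt]
    have e2 : ∫⁻ p, edist p.1 x ^ 2 ∂q = ∫⁻ z, edist z x ^ 2 ∂μ := by
      rw [← hq.1, lintegral_map (by fun_prop) measurable_fst]
    rw [e2]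
    have f1 := (Wsq_lt_top hμ hν).ne
    have f2 := (hμ.all x).ne
    rw [lt_top_iff_ne_top]
    finiteness
  · simp only [e0, e1]
    rcases le_total s t with h | h
    · exact hmain s hs t ht h
    · rw [W2_comm, abs_sub_comm]; exact hmain t ht s hs h

lemma geodesic_of_geodesicW2 (hX : GeodesicW2 X) : GeodesicSpace X := by
  apply geodesic_of_midpoints
  intro x y
  obtain ⟨γ, h0, h1, hP, hγ⟩ := hX _ _ (memP2_dirac x) (memP2_dirac y)
  have hm : (1/2 : ℝ) ∈ Icc (0:ℝ) 1 := by constructor <;> norm_num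
  have hp := (hP _ hm).1
  have a1 := hγ 0 (by simp) _ hm
  have a2 := hγ 1 (by simp) _ hm
  rw [h0, h1, W2_dirac_dirac] at a1 a2
  have c1 : |(0:ℝ) - 1/2| = 1/2 := by norm_num [abs_of_neg]
  have c2 : |(1:ℝ) - 1/2| = 1/2 := by norm_num
  rw [c1] at a1
  rw [c2] at a2
  have c4 : 4 * (ENNReal.ofReal (1/2) * edist x y) ^ 2 = edist x y ^ 2 := by
    rw [mul_pow, ← mul_assoc, ← ENNReal.ofReal_pow (by norm_num)]
    have : (4:ℝ≥0∞) = ENNReal.ofReal 4 := by norm_num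
    rw [this, ← ENNReal.ofReal_mul (by norm_num)]
    norm_num
  have b1 := congrArg (fun w => 4 * w ^ 2) a1
  have b2 := congrArg (fun w => 4 * w ^ 2) a2
  simp only [W2_sq, Wsq_dirac, c4] at b1 b2
  have key := (mid_rigid (γ (1/2)) (fun z => edist x z) (fun z => edist y z) (fun _ => edist x y)
    (by fun_prop) (by fun_prop) (by fun_prop) (fun z => edist_ne_top _ _) (fun z => edist_ne_top _ _)
    (fun z => edist_triangle_right x y z) (edist x y ^ 2) (by finiteness) b1.le b2.le (by rw [lintegral_const, measure_univ, mul_one])).1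
  obtain ⟨z, hz1, hz2⟩ := key.exists
  simp only [edist_dist, ENNReal.toReal_ofReal dist_nonneg] at hz1 hz2
  exact ⟨z, hz1, by rw [dist_comm]; exact hz2⟩

lemma nnCurv_of_nnCurvW2 (h : NNCurvW2 X) : NNCurvMidpoint X := by
  intro x y z w h1 h2
  have := h (Measure.dirac x) (Measure.dirac y) (Measure.dirac z) (Measure.dirac w)
    (memP2_dirac x) (memP2_dirac y) (memP2_dirac z) (memP2_dirac w)
  simp only [W2_dirac_dirac, edist_dist, ENNReal.toReal_ofReal dist_nonneg] at this
  exact this h1 h2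

lemma nnCurvW2_of_nnCurv (h : NNCurvMidpoint X) : NNCurvW2 X := by
  intro μ ν κ w hμ hν hκ hw h1 h2
  have hμp := hμ.1
  have hνp := hν.1
  have hκp := hκ.1
  have hwp := hw.1
  have hne : Nonempty X := nonempty_of_isProbabilityMeasure μ
  rw [W2_real_sq, W2_real_sq, W2_real_sq, W2_real_sq]
  have h1' := congrArg (fun t => 4 * t ^ 2) h1
  have h2' := congrArg (fun t => 4 * t ^ 2) h2
  simp only [div_pow, W2_real_sq] at h1' h2'
  have fνκ := (Wsq_lt_top hν hκ).ne
  have fνw := (Wsq_lt_top hν hw).ne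
  have fκw := (Wsq_lt_top hκ hw).ne
  have fμw := (Wsq_lt_top hμ hw).ne
  have fμν := (Wsq_lt_top hμ hν).ne
  have fμκ := (Wsq_lt_top hμ hκ).ne
  have k1 : 4 * Wsq ν w ≤ Wsq ν κ := by
    rw [← ENNReal.toReal_le_toReal (by finiteness) fνκ, ENNReal.toReal_mul]
    norm_num; linarith
  have k2 : 4 * Wsq w κ ≤ Wsq ν κ := by
    rw [Wsq_comm w κ, ← ENNReal.toReal_le_toReal (by finiteness) fνκ, ENNReal.toReal_mul]
    norm_num; linarith
  obtain ⟨q1, hq1, o1⟩ := exists_optimal ν w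
  obtain ⟨q2, hq2, o2⟩ := exists_optimal w κ
  obtain ⟨q3, hq3, o3⟩ := exists_optimal w μ
  have := hq1.isProb hνp
  have := hq2.isProb hwp
  have := hq3.isProb hwp
  obtain ⟨g, hg1, hg2⟩ := glue q1 q2 (hq1.2.trans hq2.1.symm)
  have hgp : IsProbabilityMeasure g := by
    constructor
    have := measure_univ (μ := q1)
    rw [← hg1, Measure.map_apply measurable_fst MeasurableSet.univ] at this
    simpa using this
  -- reorder: ((y, z), w)
  let g' : Measure ((X × X) × X) := g.map fun p => ((p.1.1, p.2), p.1.2)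
  have hφ : Measurable fun p : (X × X) × X => ((p.1.1, p.2), p.1.2) := by fun_prop
  have hg'p : IsProbabilityMeasure g' := Measure.isProbabilityMeasure_map hφ.aemeasurable
  have m1 : g'.map (fun p => (p.1.1, p.2)) = q1 := by
    rw [Measure.map_map (by fun_prop) hφ, ← hg1]; rfl
  have m2 : g'.map (fun p => (p.2, p.1.2)) = q2 := by
    rw [Measure.map_map (by fun_prop) hφ, ← hg2]; rfl
  have mw : g'.map Prod.snd = w := by
    rw [← hq1.2, ← m1, Measure.map_map (μ := g') measurable_snd (by fun_prop)]; rfl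
  obtain ⟨G, hG1, hG2⟩ := glue g' q3 (mw.trans hq3.1.symm)
  -- points of `G`: `(((y, z), w), x)`
  have M1 : G.map (fun p => (p.1.1.1, p.1.2)) = q1 := by
    rw [← m1, ← hG1, Measure.map_map (by fun_prop) (by fun_prop)]; rfl
  have M2 : G.map (fun p => (p.1.2, p.1.1.2)) = q2 := by
    rw [← m2, ← hG1, Measure.map_map (by fun_prop) (by fun_prop)]; rfl
  have My : G.map (fun p => p.1.1.1) = ν := by
    rw [← hq1.1, ← M1, Measure.map_map measurable_fst (by fun_prop)]; rfl
  have Mz : G.map (fun p => p.1.1.2) = κ := by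
    rw [← hq2.2, ← M2, Measure.map_map measurable_snd (by fun_prop)]; rfl
  have Mx : G.map (fun p => p.2) = μ := by
    rw [← hq3.2, ← hG2, Measure.map_map measurable_snd (by fun_prop)]; rfl
  have Cyz : IsCoupling (G.map fun p => (p.1.1.1, p.1.1.2)) ν κ := by
    refine ⟨?_, ?_⟩
    · rw [Measure.map_map measurable_fst (by fun_prop)]; exact My
    · rw [Measure.map_map measurable_snd (by fun_prop)]; exact Mz
  have Cxy : IsCoupling (G.map fun p => (p.2, p.1.1.1)) μ ν := by
    refine ⟨?_, ?_⟩
    · rw [Measure.map_map measurable_fst (by fun_prop)]; exact Mx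
    · rw [Measure.map_map measurable_snd (by fun_prop)]; exact My
  have Cxz : IsCoupling (G.map fun p => (p.2, p.1.1.2)) μ κ := by
    refine ⟨?_, ?_⟩
    · rw [Measure.map_map measurable_fst (by fun_prop)]; exact Mx
    · rw [Measure.map_map measurable_snd (by fun_prop)]; exact Mz
  have Iyw : ∫⁻ p, edist p.1.1.1 p.1.2 ^ 2 ∂G = Wsq ν w := by
    rw [← o1, ← M1, lintegral_map meas_cost (by fun_prop)]
  have Iwz : ∫⁻ p, edist p.1.2 p.1.1.2 ^ 2 ∂G = Wsq w κ := by
    rw [← o2, ← M2, lintegral_map meas_cost (by fun_prop)]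
  have Iwx : ∫⁻ p, edist p.1.2 p.2 ^ 2 ∂G = Wsq w μ := by
    rw [← o3, ← hG2, lintegral_map meas_cost (by fun_prop)]
  have Iyz : Wsq ν κ ≤ ∫⁻ p, edist p.1.1.1 p.1.1.2 ^ 2 ∂G := by
    refine (Wsq_le Cyz).trans_eq ?_
    rw [lintegral_map meas_cost (by fun_prop)]
  have Ixy : Wsq μ ν ≤ ∫⁻ p, edist p.2 p.1.1.1 ^ 2 ∂G := by
    refine (Wsq_le Cxy).trans_eq ?_
    rw [lintegral_map meas_cost (by fun_prop)]
  have Ixz : Wsq μ κ ≤ ∫⁻ p, edist p.2 p.1.1.2 ^ 2 ∂G := by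
    refine (Wsq_le Cxz).trans_eq ?_
    rw [lintegral_map meas_cost (by fun_prop)]
  obtain ⟨hae, hD⟩ := mid_rigid G (fun p => edist p.1.1.1 p.1.2) (fun p => edist p.1.2 p.1.1.2)
    (fun p => edist p.1.1.1 p.1.1.2) (by fun_prop) (by fun_prop) (by fun_prop)
    (fun p => edist_ne_top _ _) (fun p => edist_ne_top _ _) (fun p => edist_triangle _ _ _)
    (Wsq ν κ) fνκ (by rw [Iyw]; exact k1) (by rw [Iwz]; exact k2) Iyz
  have hpt : ∀ᵐ p ∂G, 2 * edist p.2 p.1.1.1 ^ 2 + 2 * edist p.2 p.1.1.2 ^ 2 ≤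
      4 * edist p.1.2 p.2 ^ 2 + edist p.1.1.1 p.1.1.2 ^ 2 := by
    filter_upwards [hae] with p hp
    simp only [edist_dist, ENNReal.toReal_ofReal dist_nonneg] at hp
    have := h p.2 p.1.1.1 p.1.1.2 p.1.2 hp.1 (by rw [dist_comm]; exact hp.2)
    rw [dist_comm p.2 p.1.2] at this
    rw [← ENNReal.toReal_le_toReal (by finiteness) (by finiteness),
      ENNReal.toReal_add (by finiteness) (by finiteness),
      ENNReal.toReal_add (by finiteness) (by finiteness)]
    simp only [ENNReal.toReal_mul, ENNReal.toReal_pow, edist_dist,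
      ENNReal.toReal_ofReal dist_nonneg, ENNReal.toReal_ofNat]
    linarith
  have hint := lintegral_mono_ae hpt
  rw [lintegral_add_right _ (by fun_prop), lintegral_add_right _ (by fun_prop),
    lintegral_const_mul _ (by fun_prop), lintegral_const_mul _ (by fun_prop),
    lintegral_const_mul _ (by fun_prop), Iwx, hD, Wsq_comm w μ] at hint
  have hfinal : 2 * Wsq μ ν + 2 * Wsq μ κ ≤ 4 * Wsq μ w + Wsq ν κ :=
    le_trans (by gcongr) hint
  rw [← ENNReal.toReal_le_toReal (by finiteness) (by finiteness),
      ENNReal.toReal_add (by finiteness) (by finiteness),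
      ENNReal.toReal_add (by finiteness) (by finiteness)] at hfinal
  simp only [ENNReal.toReal_mul, ENNReal.toReal_ofNat] at hfinal
  linarith

end W

/-- **Geodesics and nonnegative curvature in the Wasserstein space.** `(P₂(X), W₂)` is a
geodesic space iff `X` is; and if `X` is geodesic, then `(P₂(X), W₂)` satisfies the
nonnegative-curvature midpoint comparison iff `X` does. -/
theorem wasserstein_geodesic_and_nonneg_curvature
    {X : Type*} [MetricSpace X] [CompleteSpace X] [TopologicalSpace.SeparableSpace X]
    [MeasurableSpace X] [BorelSpace X] :
    (GeodesicW2 X ↔ GeodesicSpace X) ∧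
    (GeodesicSpace X → (NNCurvW2 X ↔ NNCurvMidpoint X)) := by
  have : SecondCountableTopology X := UniformSpace.secondCountable_of_separable X
  exact ⟨⟨geodesic_of_geodesicW2, geodesicW2_of_geodesic⟩,
    fun _ => ⟨nnCurv_of_nnCurvW2, nnCurvW2_of_nnCurv⟩⟩

end
end

section
/- On mm₁-spaces of finite size, the L²-distortion distance Δ₂ is finite, symmetric, satisfies the triangle inequality, and Δ₂((X₀,d₀,m₀),(X₁,d₁,m₁)) = 0 if and only if the two spaces are isomorphic. Moreover, for any two mm₁-spaces Y, Z of finite size there exists an mm₁-space W of finite size with Δ₂(Y,W) = Δ₂(Z,W) = ½·Δ₂(Y,Z) (a midpoint), and the nonnegative-curvature midpoint comparison holds: for all mm₁-spaces X, Y, Z of finite size and every such midpoint W of Y and Z, Δ₂(X,W)² ≥ ½Δ₂(X,Y)² + ½Δ₂(X,Z)² − ¼Δ₂(Y,Z)². -/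
open MeasureTheory Filter Set Topology ENNReal
open scoped Classical

noncomputable section

/-- A normalized metric measure space (mm₁-space): a complete separable metric space
equipped with a Borel probability measure. -/
structure MM1 : Type 1 where
  carrier : Type
  met : MetricSpace carrier
  cpl : CompleteSpace carrier
  sep : TopologicalSpace.SeparableSpace carrier
  mea : MeasurableSpace carrier
  bor : BorelSpace carrier
  m : MeasureTheory.Measure carrier
  prob : MeasureTheory.IsProbabilityMeasure m

attribute [instance] MM1.met MM1.cpl MM1.sep MM1.mea MM1.bor MM1.prob

/-- An mm₁-space has finite size iff `∫∫ d(x,y)² dm dm < ∞`. -/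
def FiniteSize (Y : MM1) : Prop :=
  (∫⁻ x, ∫⁻ y, edist x y ^ 2 ∂Y.m ∂Y.m) < ∞

/-- A coupling of the metrics: a complete separable metric on the disjoint union
restricting to the given metrics on the two pieces. -/
def IsMetricCoupling {α β : Type*} [MetricSpace α] [MetricSpace β]
    (D : α ⊕ β → α ⊕ β → ℝ) : Prop :=
  (∀ p, D p p = 0) ∧ (∀ p q, D p q = D q p) ∧ (∀ p q r, D p r ≤ D p q + D q r) ∧
  (∀ p q, D p q = 0 → p = q) ∧
  (∀ x y : α, D (Sum.inl x) (Sum.inl y) = dist x y) ∧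
  (∀ x y : β, D (Sum.inr x) (Sum.inr y) = dist x y) ∧
  (∀ u : ℕ → α ⊕ β, (∀ ε : ℝ, 0 < ε → ∃ N, ∀ j ≥ N, ∀ k ≥ N, D (u j) (u k) < ε) →
    ∃ p, Filter.Tendsto (fun n => D (u n) p) Filter.atTop (nhds 0)) ∧
  (∃ S : Set (α ⊕ β), S.Countable ∧ ∀ p : α ⊕ β, ∀ ε : ℝ, 0 < ε → ∃ s ∈ S, D p s < ε)

/-- The L²-transportation distance between mm₁-spaces. -/
def D2 (Y₀ Y₁ : MM1) : ℝ≥0∞ :=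
  ⨅ (q : Measure (Y₀.carrier × Y₁.carrier)) (_ : IsCoupling q Y₀.m Y₁.m)
    (D : Y₀.carrier ⊕ Y₁.carrier → Y₀.carrier ⊕ Y₁.carrier → ℝ) (_ : IsMetricCoupling D),
    (∫⁻ p, ENNReal.ofReal (D (Sum.inl p.1) (Sum.inr p.2)) ^ 2 ∂q) ^ (1/2 : ℝ)

/-- The L²-distortion distance between mm₁-spaces. -/
def Delta2 (Y₀ Y₁ : MM1) : ℝ≥0∞ :=
  ⨅ (q : Measure (Y₀.carrier × Y₁.carrier)) (_ : IsCoupling q Y₀.m Y₁.m),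
    (∫⁻ p, ∫⁻ p', ENNReal.ofReal |dist p.1 p'.1 - dist p.2 p'.2| ^ 2 ∂q ∂q) ^ (1/2 : ℝ)

/-- Two mm₁-spaces are isomorphic iff there is a measure-preserving isometry
between the supports of their measures. -/
def MMIsomorphic (Y Z : MM1) : Prop :=
  ∃ f : Y.carrier → Z.carrier, Measurable f ∧
    (∀ x ∈ mmSupp Y.m, ∀ y ∈ mmSupp Y.m, dist (f x) (f y) = dist x y) ∧
    f '' mmSupp Y.m = mmSupp Z.m ∧
    Measure.map f Y.m = Z.m

instance MM1.secondCountable (Y : MM1) : SecondCountableTopology Y.carrier :=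
  UniformSpace.secondCountable_of_separable _

instance MM1.standardBorel (Y : MM1) : StandardBorelSpace Y.carrier := by
  have : PolishSpace Y.carrier := ⟨⟩
  infer_instance

instance MM1.nonempty (Y : MM1) : Nonempty Y.carrier :=
  nonempty_of_isProbabilityMeasure Y.m

/-- Pulled back distance. -/
def pd {Ω : Type*} {α : Type*} [MetricSpace α] (f : Ω → α) (p : Ω × Ω) : ℝ :=
  dist (f p.1) (f p.2)

lemma IsCoupling.prob {α β : Type*} [MeasurableSpace α] [MeasurableSpace β]
    {q : Measure (α × β)} {μ : Measure α} {ν : Measure β} [IsProbabilityMeasure μ]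
    (h : IsCoupling q μ ν) : IsProbabilityMeasure q := by
  constructor
  have h1 : μ univ = 1 := measure_univ
  rw [← h.1, Measure.map_apply measurable_fst MeasurableSet.univ] at h1
  simpa using h1

lemma measurable_pd {Ω : Type*} [MeasurableSpace Ω] {Y : MM1} {f : Ω → Y.carrier}
    (hf : Measurable f) : Measurable (pd f) := by
  unfold pd
  fun_prop

/-- The double lintegral is an L² norm. -/
lemma cost_eq {Ω : Type*} [MeasurableSpace Ω] (π : Measure Ω) [IsProbabilityMeasure π]
    {Y Z : MM1} {f : Ω → Y.carrier} {g : Ω → Z.carrier} (hf : Measurable f) (hg : Measurable g) :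
    (∫⁻ p, ∫⁻ p', ENNReal.ofReal |dist (f p) (f p') - dist (g p) (g p')| ^ 2 ∂π ∂π) ^ (1/2 : ℝ)
      = eLpNorm (pd f - pd g) 2 (π.prod π) := by
  rw [eLpNorm_eq_lintegral_rpow_enorm_toReal (by norm_num) (by norm_num)]
  simp only [ENNReal.toReal_ofNat]
  congr 1
  have hm : Measurable (pd f - pd g) := (measurable_pd hf).sub (measurable_pd hg)
  rw [lintegral_prod _ (by fun_prop)]
  simp [pd, Real.enorm_eq_ofReal_abs]

lemma cost_map {Ω : Type*} [MeasurableSpace Ω] (π : Measure Ω) [IsProbabilityMeasure π]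
    {Y Z : MM1} {f : Ω → Y.carrier} {g : Ω → Z.carrier} (hf : Measurable f) (hg : Measurable g) :
    eLpNorm (pd (Prod.fst : Y.carrier × Z.carrier → Y.carrier) - pd Prod.snd) 2
        ((π.map (fun ω => (f ω, g ω))).prod (π.map (fun ω => (f ω, g ω))))
      = eLpNorm (pd f - pd g) 2 (π.prod π) := by
  have h : Measurable (fun ω => (f ω, g ω)) := hf.prodMk hg
  have hm : Measurable (pd (Prod.fst : Y.carrier × Z.carrier → Y.carrier) - pd Prod.snd) :=
    (measurable_pd measurable_fst).sub (measurable_pd measurable_snd)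
  rw [Measure.map_prod_map _ _ h h, eLpNorm_map_measure hm.aestronglyMeasurable
    (h.prodMap h).aemeasurable]
  rfl

/-- The cost of a realization bounds the distance. -/
lemma Delta2_le {Ω : Type*} [MeasurableSpace Ω] (π : Measure Ω) [IsProbabilityMeasure π]
    {Y Z : MM1} {f : Ω → Y.carrier} {g : Ω → Z.carrier} (hf : Measurable f) (hg : Measurable g)
    (hfY : π.map f = Y.m) (hgZ : π.map g = Z.m) :
    Delta2 Y Z ≤ eLpNorm (pd f - pd g) 2 (π.prod π) := by
  have h : Measurable (fun ω => (f ω, g ω)) := hf.prodMk hg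
  rw [← cost_map π hf hg]
  have : IsProbabilityMeasure (π.map (fun ω => (f ω, g ω))) :=
    Measure.isProbabilityMeasure_map h.aemeasurable
  rw [← cost_eq _ measurable_fst measurable_snd]
  refine iInf₂_le (π.map (fun ω => (f ω, g ω))) ⟨?_, ?_⟩
  · rw [Measure.map_map measurable_fst h]; exact hfY
  · rw [Measure.map_map measurable_snd h]; exact hgZ

lemma memLp_pd {Ω : Type*} [MeasurableSpace Ω] (π : Measure Ω) [IsProbabilityMeasure π]
    {Y : MM1} (hY : FiniteSize Y) {f : Ω → Y.carrier} (hf : Measurable f)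
    (hfY : π.map f = Y.m) : MemLp (pd f) 2 (π.prod π) := by
  refine ⟨(measurable_pd hf).aestronglyMeasurable, ?_⟩
  have h1 : pd f = pd (id : Y.carrier → Y.carrier) ∘ Prod.map f f := rfl
  rw [h1, ← eLpNorm_map_measure (measurable_pd measurable_id).aestronglyMeasurable
    (hf.prodMap hf).aemeasurable, ← Measure.map_prod_map _ _ hf hf, hfY,
    eLpNorm_eq_lintegral_rpow_enorm_toReal (by norm_num) (by norm_num)]
  refine ENNReal.rpow_lt_top_of_nonneg (by norm_num) (ne_of_lt ?_)
  have hm : Measurable (pd (id : Y.carrier → Y.carrier)) := measurable_pd measurable_id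
  rw [lintegral_prod _ (by fun_prop)]
  unfold FiniteSize at hY
  convert hY using 6 with x y
  simp [pd, Real.enorm_eq_ofReal_abs, edist_dist]

/-- The set of couplings is compact. -/
lemma isCompact_couplings (Y Z : MM1) :
    IsCompact {q : ProbabilityMeasure (Y.carrier × Z.carrier) |
      IsCoupling (q : Measure (Y.carrier × Z.carrier)) Y.m Z.m} := by
  set S := {q : ProbabilityMeasure (Y.carrier × Z.carrier) |
      IsCoupling (q : Measure (Y.carrier × Z.carrier)) Y.m Z.m} with hS
  have hcl : IsClosed S := by
    have e : S = (fun q : ProbabilityMeasure (Y.carrier × Z.carrier) =>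
          q.map (f := Prod.fst) measurable_fst.aemeasurable) ⁻¹' {⟨Y.m, Y.prob⟩} ∩
        (fun q : ProbabilityMeasure (Y.carrier × Z.carrier) =>
          q.map (f := Prod.snd) measurable_snd.aemeasurable) ⁻¹' {⟨Z.m, Z.prob⟩} := by
      ext q
      rw [hS, Set.mem_ofPred_eq, mem_inter_iff, mem_preimage, mem_preimage]
      constructor
      · rintro ⟨h1, h2⟩
        exact ⟨Subtype.ext h1, Subtype.ext h2⟩
      · rintro ⟨h1, h2⟩
        exact ⟨congrArg Subtype.val h1, congrArg Subtype.val h2⟩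
    rw [e]
    exact (isClosed_singleton.preimage (ProbabilityMeasure.continuous_map continuous_fst)).inter
      (isClosed_singleton.preimage (ProbabilityMeasure.continuous_map continuous_snd))
  rw [← hcl.closure_eq]
  apply isCompact_closure_of_isTightMeasureSet
  apply IsTightMeasureSet.prodMk
  · refine (isTightMeasureSet_singleton (μ := Y.m)).subset ?_
    rintro _ ⟨_, ⟨q, hq, rfl⟩, rfl⟩
    exact hq.1
  · refine (isTightMeasureSet_singleton (μ := Z.m)).subset ?_
    rintro _ ⟨_, ⟨q, hq, rfl⟩, rfl⟩
    exact hq.2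

lemma isCoupling_prod_s4 (Y Z : MM1) : IsCoupling (Y.m.prod Z.m) Y.m Z.m :=
  ⟨Measure.fst_prod (μ := Y.m) (ν := Z.m),
   Measure.snd_prod (μ := Y.m) (ν := Z.m)⟩

lemma lsc_lintegral {α : Type*} [TopologicalSpace α] [MeasurableSpace α] [BorelSpace α]
    {f : α → NNReal} (hf : Continuous f) :
    LowerSemicontinuous (fun q : ProbabilityMeasure α => ∫⁻ x, (f x : ℝ≥0∞) ∂(q : Measure α)) := by
  have e : (fun q : ProbabilityMeasure α => ∫⁻ x, (f x : ℝ≥0∞) ∂(q : Measure α)) =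
      fun q : ProbabilityMeasure α => ⨆ n : ℕ, ∫⁻ x, ((min (f x) n : NNReal) : ℝ≥0∞) ∂(q : Measure α) := by
    ext q
    rw [← lintegral_iSup]
    · congr 1
      ext x
      apply le_antisymm
      · obtain ⟨n, hn⟩ := exists_nat_ge (f x)
        exact le_iSup_of_le n (by simp [min_eq_left hn])
      · exact iSup_le fun n => by exact_mod_cast min_le_left _ _
    · intro n
      exact ((hf.min continuous_const).measurable).coe_nnreal_ennreal
    · intro n m hnm x
      have : (n : NNReal) ≤ m := by exact_mod_cast hnm
      simp only [ENNReal.coe_le_coe]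
      exact min_le_min_left _ this
  rw [e]
  apply lowerSemicontinuous_iSup
  intro n
  apply Continuous.lowerSemicontinuous
  let g : BoundedContinuousFunction α NNReal :=
    BoundedContinuousFunction.mkOfBound ⟨fun x => min (f x) n, hf.min continuous_const⟩ n (by
      intro x y
      simp only [ContinuousMap.coe_mk, NNReal.dist_eq]
      have h1 : ((min (f x) n : NNReal) : ℝ) ≤ n := by exact_mod_cast min_le_right _ _
      have h2 : ((min (f y) n : NNReal) : ℝ) ≤ n := by exact_mod_cast min_le_right _ _
      have h3 := (min (f x) n : NNReal).coe_nonneg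
      have h4 := (min (f y) n : NNReal).coe_nonneg
      rw [abs_le]
      constructor <;> linarith)
  rw [continuous_iff_continuousAt]
  intro q
  exact (ProbabilityMeasure.tendsto_iff_forall_lintegral_tendsto.1 tendsto_id g)

/-- Existence of optimal couplings. -/
lemma exists_optimal_s4 (Y Z : MM1) : ∃ q : Measure (Y.carrier × Z.carrier),
    IsCoupling q Y.m Z.m ∧ IsProbabilityMeasure q ∧
    eLpNorm (pd (Prod.fst : Y.carrier × Z.carrier → Y.carrier) - pd Prod.snd) 2 (q.prod q)
      = Delta2 Y Z := by
  let F : (Y.carrier × Z.carrier) × (Y.carrier × Z.carrier) → NNReal := fun p => ‖dist p.1.1 p.2.1 - dist p.1.2 p.2.2‖₊ ^ 2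
  have hF : Continuous F := by unfold F; fun_prop
  have hl : LowerSemicontinuous (fun q : ProbabilityMeasure (Y.carrier × Z.carrier) =>
      ∫⁻ x, (F x : ℝ≥0∞) ∂((q.prod q : ProbabilityMeasure ((Y.carrier × Z.carrier) × (Y.carrier × Z.carrier))) : Measure ((Y.carrier × Z.carrier) × (Y.carrier × Z.carrier)))) := by
    have hc : Continuous (fun q : ProbabilityMeasure (Y.carrier × Z.carrier) => q.prod q) :=
      ProbabilityMeasure.continuous_prod.comp (continuous_id.prodMk continuous_id)
    exact (lsc_lintegral hF).comp hc
  obtain ⟨q, hq, hmin⟩ := LowerSemicontinuousOn.exists_isMinOn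
    (s := {q : ProbabilityMeasure (Y.carrier × Z.carrier) | IsCoupling (q : Measure (Y.carrier × Z.carrier)) Y.m Z.m})
    ⟨⟨Y.m.prod Z.m, inferInstance⟩, isCoupling_prod_s4 Y Z⟩ (isCompact_couplings Y Z)
    (hl.lowerSemicontinuousOn _)
  have key : ∀ r : Measure (Y.carrier × Z.carrier), IsProbabilityMeasure r →
      (∫⁻ x, (F x : ℝ≥0∞) ∂(r.prod r)) =
        ∫⁻ p, ∫⁻ p', ENNReal.ofReal |dist p.1 p'.1 - dist p.2 p'.2| ^ 2 ∂r ∂r := by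
    intro r _
    rw [lintegral_prod _ (by fun_prop)]
    congr 1; ext p; congr 1; ext p'
    simp only [F, ENNReal.coe_pow]
    congr 1
    rw [← Real.enorm_eq_ofReal_abs]
    rfl
  refine ⟨q, hq, inferInstance, le_antisymm ?_ ?_⟩
  · rw [← cost_eq _ measurable_fst measurable_snd]
    refine le_iInf₂ fun r hr => ?_
    have hrp := hr.prob
    have h := hmin (show (⟨r, hrp⟩ : ProbabilityMeasure (Y.carrier × Z.carrier)) ∈ _ from hr)
    apply ENNReal.rpow_le_rpow _ (by norm_num)
    rw [← key r hrp, ← key q inferInstance]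
    exact h
  · exact Delta2_le _ measurable_fst measurable_snd hq.1 hq.2

/-- Gluing lemma. -/
lemma gluing {A B C : Type*} [MeasurableSpace A] [MeasurableSpace B] [MeasurableSpace C]
    [StandardBorelSpace C] [Nonempty C] (μ : Measure A) [IsProbabilityMeasure μ] (b : A → B)
    (hb : Measurable b)
    (ν : Measure (B × C)) [IsProbabilityMeasure ν] (h : μ.map b = ν.map Prod.fst) :
    ∃ π : Measure (A × C), IsProbabilityMeasure π ∧ π.map Prod.fst = μ ∧
      π.map (fun p => (b p.1, p.2)) = ν := by
  let κ := ν.condKernel.comap b hb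
  refine ⟨μ.compProd κ, inferInstance, ?_, ?_⟩
  · exact Measure.fst_compProd μ κ
  · have hm : Measurable (fun p : A × C => (b p.1, p.2)) := by fun_prop
    conv_rhs => rw [← ν.disintegrate ν.condKernel]
    refine Measure.ext_of_lintegral _ fun f hf => ?_
    rw [lintegral_map hf hm, Measure.lintegral_compProd (f := fun p : A × C => f (b p.1, p.2)) (hf.comp hm),
      Measure.lintegral_compProd hf,
      Measure.fst, ← h, lintegral_map (by fun_prop) hb]
    rfl

lemma Delta2_finite (Y Z : MM1) (hY : FiniteSize Y) (hZ : FiniteSize Z) : Delta2 Y Z ≠ ∞ := by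
  have hc := isCoupling_prod_s4 Y Z
  refine ne_top_of_le_ne_top ?_ (Delta2_le (Y.m.prod Z.m) measurable_fst measurable_snd hc.1 hc.2)
  exact ((memLp_pd _ hY measurable_fst hc.1).sub (memLp_pd _ hZ measurable_snd hc.2)).2.ne

lemma Delta2_le_symm (Y Z : MM1) : Delta2 Y Z ≤ Delta2 Z Y := by
  obtain ⟨q, hq, hp, h⟩ := exists_optimal_s4 Z Y
  rw [← h, ← eLpNorm_neg, neg_sub]
  exact Delta2_le q measurable_snd measurable_fst hq.2 hq.1

lemma Delta2_triangle (Y Z W : MM1) : Delta2 Y W ≤ Delta2 Y Z + Delta2 Z W := by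
  obtain ⟨q, hq, hp, h⟩ := exists_optimal_s4 Y Z
  obtain ⟨r, hr, hp', h'⟩ := exists_optimal_s4 Z W
  obtain ⟨π, hπ, h1, h2⟩ := gluing q Prod.snd measurable_snd r (by rw [hq.2, hr.1])
  have hq' : (π.map fun p => (p.1.1, p.1.2)) = q := h1
  subst h2
  rw [← h', cost_map π (by fun_prop) (by fun_prop), ← h]
  rw [← hq', cost_map π (by fun_prop) (by fun_prop)]
  have e : pd (fun ω : (Y.carrier × Z.carrier) × W.carrier => ω.1.1) - pd (fun ω => ω.2)
      = (pd (fun ω => ω.1.1) - pd (fun ω => ω.1.2)) + (pd (fun ω => ω.1.2) - pd (fun ω => ω.2)) := by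
    abel
  refine (Delta2_le π (f := fun ω => ω.1.1) (g := fun ω => ω.2) (by fun_prop) (by fun_prop) ?_ ?_).trans ?_
  · rw [← hq.1, ← h1, Measure.map_map measurable_fst measurable_fst]; rfl
  · rw [← hr.2, Measure.map_map measurable_snd (by fun_prop)]; rfl
  · rw [e]
    refine eLpNorm_add_le ?_ ?_ (by norm_num)
    · exact ((measurable_pd (by fun_prop)).sub (measurable_pd (by fun_prop))).aestronglyMeasurable
    · exact ((measurable_pd (by fun_prop)).sub (measurable_pd (by fun_prop))).aestronglyMeasurable

lemma curvature_hilbert {E : Type*} [NormedAddCommGroup E] [InnerProductSpace ℝ E]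
    (a b c w : E) (D : ℝ) (hb : ‖w - b‖ = D / 2) (hc : ‖w - c‖ = D / 2)
    (hbc : D ≤ ‖b - c‖) :
    ‖a - w‖ ^ 2 = ‖a - b‖ ^ 2 / 2 + ‖a - c‖ ^ 2 / 2 - D ^ 2 / 4 := by
  have hD : 0 ≤ D := by have := norm_nonneg (w - b); linarith
  have hp := parallelogram_law_with_norm ℝ (w - b) (w - c)
  have e1 : (w - b) - (w - c) = -(b - c) := by abel
  rw [e1, norm_neg, hb, hc] at hp
  have h0 : ‖(w - b) + (w - c)‖ = 0 := by
    have := norm_nonneg ((w - b) + (w - c))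
    nlinarith
  rw [norm_eq_zero] at h0
  have ht : w - c = -(w - b) := by rw [eq_neg_iff_add_eq_zero, add_comm]; exact h0
  have hp2 := parallelogram_law_with_norm ℝ (a - w) (w - b)
  have e2 : (a - w) + (w - b) = a - b := by abel
  have e3 : (a - w) - (w - b) = a - c := by
    rw [sub_eq_add_neg (a - w), ← ht]; abel
  rw [e2, e3, hb] at hp2
  nlinarith

lemma Delta2_curvature (X Y Z W : MM1) (hX : FiniteSize X) (hY : FiniteSize Y)
    (hZ : FiniteSize Z) (hW : FiniteSize W)
    (hYW : Delta2 Y W = Delta2 Y Z / 2) (hZW : Delta2 Z W = Delta2 Y Z / 2) :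
    (Delta2 X W).toReal ^ 2 ≥
        (Delta2 X Y).toReal ^ 2 / 2 + (Delta2 X Z).toReal ^ 2 / 2
          - (Delta2 Y Z).toReal ^ 2 / 4 := by
  obtain ⟨q, hq, hp, h⟩ := exists_optimal_s4 X W
  obtain ⟨r, hr, hp', h'⟩ := exists_optimal_s4 W Y
  obtain ⟨s, hs, hp'', h''⟩ := exists_optimal_s4 W Z
  obtain ⟨σ, hσ, h1, h2⟩ := gluing q Prod.snd measurable_snd r (by rw [hq.2, hr.1])
  have hσW : σ.map (fun p => p.1.2) = W.m := by
    rw [← hq.2, ← h1, Measure.map_map measurable_snd measurable_fst]; rfl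
  obtain ⟨π, hπ, h3, h4⟩ := gluing σ (fun p => p.1.2) (by fun_prop) s (by rw [hs.1, hσW])
  have gq : (π.map fun p => (p.1.1.1, p.1.1.2)) = q := by
    rw [← h1, ← h3, Measure.map_map measurable_fst measurable_fst]; rfl
  have gr : (π.map fun p => (p.1.1.2, p.1.2)) = r := by
    rw [← h2, ← h3, Measure.map_map (by fun_prop) measurable_fst]; rfl
  have gX : π.map (fun p => p.1.1.1) = X.m := by
    rw [← hq.1, ← gq, Measure.map_map measurable_fst (by fun_prop)]; rfl
  have gW : π.map (fun p => p.1.1.2) = W.m := by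
    rw [← hq.2, ← gq, Measure.map_map measurable_snd (by fun_prop)]; rfl
  have gY : π.map (fun p => p.1.2) = Y.m := by
    rw [← hr.2, ← gr, Measure.map_map measurable_snd (by fun_prop)]; rfl
  have gZ : π.map (fun p => p.2) = Z.m := by
    rw [← hs.2, ← h4, Measure.map_map measurable_snd (by fun_prop)]; rfl
  have mX := memLp_pd π hX (by fun_prop) gX
  have mY := memLp_pd π hY (by fun_prop) gY
  have mZ := memLp_pd π hZ (by fun_prop) gZ
  have mW := memLp_pd π hW (by fun_prop) gW
  rw [← gq, cost_map π (by fun_prop) (by fun_prop)] at h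
  rw [← gr, cost_map π (by fun_prop) (by fun_prop)] at h'
  rw [← h4, cost_map π (by fun_prop) (by fun_prop)] at h''
  have nXW : ‖mX.toLp - mW.toLp‖ = (Delta2 X W).toReal := by
    rw [← MemLp.toLp_sub, Lp.norm_toLp, ← h]
  have nWY : ‖mW.toLp - mY.toLp‖ = (Delta2 Y Z).toReal / 2 := by
    rw [← MemLp.toLp_sub, Lp.norm_toLp, h', le_antisymm (Delta2_le_symm W Y) (Delta2_le_symm Y W),
      hYW, ENNReal.toReal_div]; rfl
  have nWZ : ‖mW.toLp - mZ.toLp‖ = (Delta2 Y Z).toReal / 2 := by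
    rw [← MemLp.toLp_sub, Lp.norm_toLp, h'', le_antisymm (Delta2_le_symm W Z) (Delta2_le_symm Z W),
      hZW, ENNReal.toReal_div]; rfl
  have nYZ : (Delta2 Y Z).toReal ≤ ‖mY.toLp - mZ.toLp‖ := by
    rw [← MemLp.toLp_sub, Lp.norm_toLp]
    exact ENNReal.toReal_mono (mY.sub mZ).2.ne (Delta2_le π (by fun_prop) (by fun_prop) gY gZ)
  have nXY : (Delta2 X Y).toReal ≤ ‖mX.toLp - mY.toLp‖ := by
    rw [← MemLp.toLp_sub, Lp.norm_toLp]
    exact ENNReal.toReal_mono (mX.sub mY).2.ne (Delta2_le π (by fun_prop) (by fun_prop) gX gY)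
  have nXZ : (Delta2 X Z).toReal ≤ ‖mX.toLp - mZ.toLp‖ := by
    rw [← MemLp.toLp_sub, Lp.norm_toLp]
    exact ENNReal.toReal_mono (mX.sub mZ).2.ne (Delta2_le π (by fun_prop) (by fun_prop) gX gZ)
  have key := curvature_hilbert mX.toLp mY.toLp mZ.toLp mW.toLp _ nWY nWZ nYZ
  rw [nXW] at key
  rw [key]
  have i1 := pow_le_pow_left₀ ENNReal.toReal_nonneg nXY 2
  have i2 := pow_le_pow_left₀ ENNReal.toReal_nonneg nXZ 2
  linarith

/-- The half-sum metric, before fixing the uniformity. -/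
def midPre (α β : Type*) [MetricSpace α] [MetricSpace β] : PseudoMetricSpace (α × β) where
  dist p q := (dist p.1 q.1 + dist p.2 q.2) / 2
  dist_self p := by simp
  dist_comm p q := by simp [dist_comm]
  dist_triangle p q r := by
    have h1 := dist_triangle p.1 q.1 r.1
    have h2 := dist_triangle p.2 q.2 r.2
    linarith

lemma midPre_uniformity (α β : Type*) [MetricSpace α] [MetricSpace β] :
    uniformity (α × β) = @uniformity _ (midPre α β).toUniformSpace := by
  refine (Metric.uniformity_basis_dist (α := α × β)).ext
    (@Metric.uniformity_basis_dist _ (midPre α β)) ?_ ?_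
  · intro ε hε
    refine ⟨ε / 2, half_pos hε, fun p hp => ?_⟩
    have hp' : (dist p.1.1 p.2.1 + dist p.1.2 p.2.2) / 2 < ε / 2 := hp
    have h1 := dist_nonneg (x := p.1.1) (y := p.2.1)
    have h2 := dist_nonneg (x := p.1.2) (y := p.2.2)
    change dist p.1 p.2 < ε
    rw [Prod.dist_eq]
    exact max_lt (by linarith) (by linarith)
  · intro ε hε
    refine ⟨ε, hε, fun p hp => ?_⟩
    have hp' : dist p.1 p.2 < ε := hp
    rw [Prod.dist_eq, max_lt_iff] at hp'
    change (dist p.1.1 p.2.1 + dist p.1.2 p.2.2) / 2 < ε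
    have hlt1 := hp'.1
    have hlt2 := hp'.2
    linarith

/-- The half-sum metric on a product. -/
def midMetric (α β : Type*) [MetricSpace α] [MetricSpace β] : MetricSpace (α × β) where
  toPseudoMetricSpace := (midPre α β).replaceUniformity (midPre_uniformity α β)
  eq_of_dist_eq_zero := by
    intro p q h
    have h' : (dist p.1 q.1 + dist p.2 q.2) / 2 = 0 := h
    have h1 := dist_nonneg (x := p.1) (y := q.1)
    have h2 := dist_nonneg (x := p.2) (y := q.2)
    exact Prod.ext (dist_eq_zero.1 (by linarith)) (dist_eq_zero.1 (by linarith))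

/-- The midpoint space associated with a coupling. -/
def midSpace (Y Z : MM1) (q : Measure (Y.carrier × Z.carrier)) (hq : IsProbabilityMeasure q) :
    MM1 where
  carrier := Y.carrier × Z.carrier
  met := midMetric Y.carrier Z.carrier
  cpl := inferInstanceAs (CompleteSpace (Y.carrier × Z.carrier))
  sep := inferInstanceAs (TopologicalSpace.SeparableSpace (Y.carrier × Z.carrier))
  mea := inferInstance
  bor := inferInstanceAs (BorelSpace (Y.carrier × Z.carrier))
  m := q
  prob := hq

lemma finiteSize_of_memLp {Y : MM1}
    (h : MemLp (pd (id : Y.carrier → Y.carrier)) 2 (Y.m.prod Y.m)) : FiniteSize Y := by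
  have h2 := lintegral_rpow_enorm_lt_top_of_eLpNorm_lt_top (by norm_num) (by norm_num) h.2
  have hm : Measurable (pd (id : Y.carrier → Y.carrier)) := measurable_pd measurable_id
  rw [lintegral_prod _ (by fun_prop)] at h2
  unfold FiniteSize
  convert h2 using 6 with x y
  simp [pd, Real.enorm_eq_ofReal_abs, edist_dist]

lemma Delta2_midpoint (Y Z : MM1) (hY : FiniteSize Y) (hZ : FiniteSize Z) :
    ∃ W : MM1, FiniteSize W ∧
      Delta2 Y W = Delta2 Y Z / 2 ∧ Delta2 Z W = Delta2 Y Z / 2 := by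
  obtain ⟨q, hq, hp, h⟩ := exists_optimal_s4 Y Z
  let i : Y.carrier × Z.carrier → (midSpace Y Z q hp).carrier := fun p => p
  have hi : Measurable i := measurable_id
  have hiq : q.map i = (midSpace Y Z q hp).m := Measure.map_id
  have hpd : pd i = (1/2 : ℝ) • (pd Prod.fst + pd Prod.snd) := by
    ext p
    change (dist p.1.1 p.2.1 + dist p.1.2 p.2.2) / 2
      = (1/2 : ℝ) * (dist p.1.1 p.2.1 + dist p.1.2 p.2.2)
    ring
  have mY := memLp_pd q hY measurable_fst hq.1
  have mZ := memLp_pd q hZ measurable_snd hq.2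
  have half : ‖(1/2 : ℝ)‖ₑ = 2⁻¹ := by
    rw [Real.enorm_eq_ofReal (by norm_num), one_div, ENNReal.ofReal_inv_of_pos (by norm_num)]
    simp
  have l1 : Delta2 Y (midSpace Y Z q hp) ≤ Delta2 Y Z / 2 := by
    refine (Delta2_le q measurable_fst hi hq.1 hiq).trans (le_of_eq ?_)
    have e : pd Prod.fst - pd i = (1/2 : ℝ) • (pd Prod.fst - pd Prod.snd) := by
      rw [hpd]; module
    rw [e, eLpNorm_const_smul, h, half, ENNReal.div_eq_inv_mul]
  have l2 : Delta2 Z (midSpace Y Z q hp) ≤ Delta2 Y Z / 2 := by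
    refine (Delta2_le q measurable_snd hi hq.2 hiq).trans (le_of_eq ?_)
    have e : pd Prod.snd - pd i = (-(1/2) : ℝ) • (pd Prod.fst - pd Prod.snd) := by
      rw [hpd]; module
    rw [e, eLpNorm_const_smul, h, enorm_neg, half, ENNReal.div_eq_inv_mul]
  have tri : Delta2 Y Z ≤ Delta2 Y (midSpace Y Z q hp) + Delta2 Z (midSpace Y Z q hp) :=
    (Delta2_triangle Y _ Z).trans (add_le_add le_rfl (Delta2_le_symm _ _))
  have fin : Delta2 Y Z / 2 ≠ ∞ :=
    ENNReal.div_ne_top (Delta2_finite Y Z hY hZ) (by norm_num)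
  refine ⟨midSpace Y Z q hp, ?_, le_antisymm l1 ?_, le_antisymm l2 ?_⟩
  · apply finiteSize_of_memLp
    have := (mY.add mZ).const_smul (1/2 : ℝ)
    rw [← hpd] at this
    exact this
  · by_contra hlt
    rw [not_le] at hlt
    have := ENNReal.add_lt_add_of_lt_of_le (ne_top_of_le_ne_top fin l2) hlt l2
    rw [ENNReal.add_halves] at this
    exact absurd tri (not_le.2 this)
  · by_contra hlt
    rw [not_le] at hlt
    have := ENNReal.add_lt_add_of_le_of_lt (ne_top_of_le_ne_top fin l1) l1 hlt
    rw [ENNReal.add_halves] at this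
    exact absurd tri (not_le.2 this)

lemma mmSupp_eq {α : Type*} [TopologicalSpace α] [MeasurableSpace α] (μ : Measure α) :
    mmSupp μ = μ.support := by
  ext x
  rw [Measure.mem_support_iff_forall]
  rfl

lemma Delta2_zero_of_iso (Y Z : MM1) (h : MMIsomorphic Y Z) : Delta2 Y Z = 0 := by
  obtain ⟨f, hf, hd, -, hm⟩ := h
  rw [← nonpos_iff_eq_zero]
  refine (Delta2_le Y.m measurable_id hf Measure.map_id hm).trans (le_of_eq ?_)
  have hs : ∀ᵐ x ∂Y.m, x ∈ mmSupp Y.m := by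
    rw [mmSupp_eq]; exact Measure.support_mem_ae
  have : pd (id : Y.carrier → Y.carrier) - pd f =ᵐ[Y.m.prod Y.m] 0 := by
    have h1 : ∀ᵐ p ∂(Y.m.prod Y.m), p.1 ∈ mmSupp Y.m :=
      Measure.quasiMeasurePreserving_fst.ae hs
    have h2 : ∀ᵐ p ∂(Y.m.prod Y.m), p.2 ∈ mmSupp Y.m :=
      Measure.quasiMeasurePreserving_snd.ae hs
    filter_upwards [h1, h2] with p hp1 hp2
    simp [pd, hd _ hp1 _ hp2]
  rw [eLpNorm_congr_ae this, eLpNorm_zero]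

lemma iso_of_Delta2_zero (Y Z : MM1) (h0 : Delta2 Y Z = 0) : MMIsomorphic Y Z := by
  obtain ⟨q, hq, hp, h⟩ := exists_optimal_s4 Y Z
  rw [h0, eLpNorm_eq_zero_iff ((measurable_pd measurable_fst).sub
    (measurable_pd measurable_snd)).aestronglyMeasurable (by norm_num)] at h
  set S := q.support with hS
  have hSae : ∀ᵐ p ∂q, p ∈ S := Measure.support_mem_ae
  have hSd : ∀ p ∈ S, ∀ p' ∈ S, dist p.1 p'.1 = dist p.2 p'.2 := by
    intro p hpS p' hpS'
    by_contra hne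
    let U : Set ((Y.carrier × Z.carrier) × (Y.carrier × Z.carrier)) :=
      {x | dist x.1.1 x.2.1 ≠ dist x.1.2 x.2.2}
    have hU : IsOpen U := isOpen_ne_fun (by fun_prop) (by fun_prop)
    obtain ⟨u, v, hu, hv, hpu, hpv, huv⟩ := isOpen_prod_iff.1 hU p p' hne
    have hz : q.prod q U = 0 := by
      refine measure_mono_null ?_ (ae_iff.1 h)
      intro x hx hx'
      apply hx
      exact sub_eq_zero.1 hx'
    have hz2 : q.prod q (u ×ˢ v) = 0 := measure_mono_null huv hz
    rw [Measure.prod_prod, mul_eq_zero] at hz2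
    rcases hz2 with hz2 | hz2
    · exact ((Measure.mem_support_iff_forall p).1 hpS u (hu.mem_nhds hpu)).ne' hz2
    · exact ((Measure.mem_support_iff_forall p').1 hpS' v (hv.mem_nhds hpv)).ne' hz2
  have hSc : IsClosed S := Measure.isClosed_support
  have hA : IsClosed (Prod.fst '' S) := by
    have : CompleteSpace S := hSc.completeSpace_coe
    have hiso : Isometry (fun p : S => p.1.1) := by
      refine Isometry.of_dist_eq fun p p' => ?_
      rw [Subtype.dist_eq, Prod.dist_eq, ← hSd _ p.2 _ p'.2, max_self]
    have := hiso.isClosedEmbedding.isClosed_range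
    convert this using 1
    ext y
    simp
  obtain ⟨z0⟩ := Z.nonempty
  let f : Y.carrier → Z.carrier := fun y => if hy : ∃ z, (y, z) ∈ S then hy.choose else z0
  have hfS : ∀ p ∈ S, f p.1 = p.2 := by
    intro p hpS
    have hy : ∃ z, (p.1, z) ∈ S := ⟨p.2, hpS⟩
    have e : f p.1 = hy.choose := dif_pos hy
    have h1 := hSd _ hy.choose_spec _ hpS
    rw [e, ← dist_eq_zero, ← h1, dist_self]
  have hfd : ∀ x ∈ Prod.fst '' S, ∀ y ∈ Prod.fst '' S, dist (f x) (f y) = dist x y := by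
    rintro _ ⟨p, hpS, rfl⟩ _ ⟨p', hpS', rfl⟩
    rw [hfS p hpS, hfS p' hpS', hSd p hpS p' hpS']
  have hfm : Measurable f := by
    refine measurable_of_restrict_of_restrict_compl hA.measurableSet ?_ ?_
    · apply Continuous.measurable
      apply Isometry.continuous
      exact Isometry.of_dist_eq fun x y => hfd _ x.2 _ y.2
    · have : (Prod.fst '' S)ᶜ.domRestrict f = fun _ => z0 := by
        ext ⟨y, hy⟩
        refine dif_neg ?_
        rintro ⟨z, hz⟩
        exact hy ⟨_, hz, rfl⟩
      rw [this]
      exact measurable_const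
  have hsY : mmSupp Y.m = Prod.fst '' S := by
    rw [mmSupp_eq]
    apply subset_antisymm
    · apply Measure.support_subset_of_isClosed hA
      rw [← hq.1]
      rw [mem_ae_map_iff measurable_fst.aemeasurable hA.measurableSet]
      filter_upwards [hSae] with p hpS
      exact ⟨p, hpS, rfl⟩
    · rintro _ ⟨p, hpS, rfl⟩
      rw [Measure.mem_support_iff_forall]
      intro U hU
      rw [← hq.1]
      refine lt_of_lt_of_le ?_ (Measure.le_map_apply measurable_fst.aemeasurable U)
      exact (Measure.mem_support_iff_forall p).1 hpS _ (continuous_fst.continuousAt hU)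
  have hB : IsClosed (Prod.snd '' S) := by
    have : CompleteSpace S := hSc.completeSpace_coe
    have hiso : Isometry (fun p : S => p.1.2) := by
      refine Isometry.of_dist_eq fun p p' => ?_
      rw [Subtype.dist_eq, Prod.dist_eq, hSd _ p.2 _ p'.2, max_self]
    have := hiso.isClosedEmbedding.isClosed_range
    convert this using 1
    ext y
    simp
  have hsZ : mmSupp Z.m = Prod.snd '' S := by
    rw [mmSupp_eq]
    apply subset_antisymm
    · apply Measure.support_subset_of_isClosed hB
      rw [← hq.2]
      rw [mem_ae_map_iff measurable_snd.aemeasurable hB.measurableSet]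
      filter_upwards [hSae] with p hpS
      exact ⟨p, hpS, rfl⟩
    · rintro _ ⟨p, hpS, rfl⟩
      rw [Measure.mem_support_iff_forall]
      intro U hU
      rw [← hq.2]
      refine lt_of_lt_of_le ?_ (Measure.le_map_apply measurable_snd.aemeasurable U)
      exact (Measure.mem_support_iff_forall p).1 hpS _ (continuous_snd.continuousAt hU)
  refine ⟨f, hfm, ?_, ?_, ?_⟩
  · rw [hsY]; exact hfd
  · rw [hsY, hsZ, image_image]
    exact image_congr hfS
  · rw [← hq.1, ← hq.2, Measure.map_map hfm measurable_fst]
    apply Measure.map_congr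
    filter_upwards [hSae] with p hpS
    exact hfS p hpS

/-- **`Δ₂` is a metric on isomorphism classes of mm₁-spaces of finite size, with midpoints,
and the space of spaces has nonnegative curvature in the sense of the midpoint comparison.** -/
theorem Delta2_metric_midpoints_nonneg_curvature :
    (∀ Y Z : MM1, FiniteSize Y → FiniteSize Z → Delta2 Y Z ≠ ∞) ∧
    (∀ Y Z : MM1, FiniteSize Y → FiniteSize Z → Delta2 Y Z = Delta2 Z Y) ∧
    (∀ Y Z W : MM1, FiniteSize Y → FiniteSize Z → FiniteSize W →
      Delta2 Y W ≤ Delta2 Y Z + Delta2 Z W) ∧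
    (∀ Y Z : MM1, FiniteSize Y → FiniteSize Z → (Delta2 Y Z = 0 ↔ MMIsomorphic Y Z)) ∧
    (∀ Y Z : MM1, FiniteSize Y → FiniteSize Z → ∃ W : MM1, FiniteSize W ∧
      Delta2 Y W = Delta2 Y Z / 2 ∧ Delta2 Z W = Delta2 Y Z / 2) ∧
    (∀ X Y Z W : MM1, FiniteSize X → FiniteSize Y → FiniteSize Z → FiniteSize W →
      Delta2 Y W = Delta2 Y Z / 2 → Delta2 Z W = Delta2 Y Z / 2 →
      (Delta2 X W).toReal ^ 2 ≥
        (Delta2 X Y).toReal ^ 2 / 2 + (Delta2 X Z).toReal ^ 2 / 2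
          - (Delta2 Y Z).toReal ^ 2 / 4) := by
  refine ⟨Delta2_finite, fun Y Z _ _ => le_antisymm (Delta2_le_symm Y Z) (Delta2_le_symm Z Y),
    fun Y Z W _ _ _ => Delta2_triangle Y Z W,
    fun Y Z _ _ => ⟨iso_of_Delta2_zero Y Z, Delta2_zero_of_iso Y Z⟩,
    Delta2_midpoint, Delta2_curvature⟩

end
end
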